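/- Septic counting estimate (Lemma 3.11): Let 1 < α ≤ 3/2, and define Λ(n_1,n_2,n_3) = Σ over all sign choices (ε_123, ε_1, ε_2, ε_3) ∈ {−1,+1}⁴ of Σ_{m ∈ ℤ} ⟨m⟩^{−1} · ⟪n_1+n_2+n_3⟫^{−1} · (Π_{j=1}^3 ⟪n_j⟫^{−1}) · 1_{|κ_2(n_1,n_2,n_3) − m| ≤ 1}. Let 𝒫 be a pairing of {1,…,7} which respects the partition {1,2,3}, {4,5,6}, {7}, and set n_nr = Σ_{j unpaired} n_j. Then there exist θ > 0 and C > 0, depending only on α and 𝒫, such that for all dyadic numbers N_1, …, N_7 ≥ 1, Σ over the variables (n_j)_{j unpaired in 𝒫} ranging over ℤ³ of ⟨n_nr⟩^{−1} · ( Σ over admissible assignments of the paired variables (n_j)_{j paired in 𝒫} of (Π_{j=1}^7 1_{|n_j| ∼ N_j}) · Λ(n_1,n_2,n_3) · Λ(n_4,n_5,n_6) · ⟪n_7⟫^{−1} )² ≤ C · N_max^{−θ}, where N_max = max(N_1, …, N_7). -/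

import Mathlib

noncomputable section

open scoped BigOperators

/-- Japanese bracket of a real number: `⟨x⟩ = (1 + x²)^{1/2}`. -/
def rjb (x : ℝ) : ℝ := Real.sqrt (1 + x ^ 2)

/-- Euclidean norm of a lattice point in `ℤ³`. -/
def znorm (n : Fin 3 → ℤ) : ℝ := Real.sqrt (∑ i, ((n i : ℝ)) ^ 2)

/-- Japanese bracket `⟨n⟩ = (1 + |n|²)^{1/2}` of a lattice point in `ℤ³`. -/
def jb (n : Fin 3 → ℤ) : ℝ := Real.sqrt (1 + ∑ i, ((n i : ℝ)) ^ 2)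

/-- The modified bracket `⟪n⟫ = (⟨n⟩^{2α} − 1/4)^{1/2}`. -/
def jbb (α : ℝ) (n : Fin 3 → ℤ) : ℝ := Real.sqrt (jb n ^ (2 * α) - 1 / 4)

/-- Dyadic numbers `2^j`, `j ≥ 0`. -/
def IsDyadic (N : ℝ) : Prop := ∃ j : ℕ, N = 2 ^ j

/-- `|n| ∼ N` for a dyadic number `N`: `N/2 < |n| ≤ N` if `N ≥ 2`, and `|n| ≤ 1` if `N = 1`. -/
def SimFreq (N : ℝ) (n : Fin 3 → ℤ) : Prop :=
  (2 ≤ N ∧ N / 2 < znorm n ∧ znorm n ≤ N) ∨ (N < 2 ∧ znorm n ≤ 1)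

/-- `x` is a sign `±1`. -/
def IsSign (x : ℝ) : Prop := x = 1 ∨ x = -1

open Classical in
/-- Real-valued indicator of a proposition. -/
def ind (p : Prop) : ℝ := if p then 1 else 0

/-- The sign `±1` attached to a boolean. -/
def sgn (b : Bool) : ℝ := if b then 1 else -1

/-- `Λ(n₁,n₂,n₃) = Σ_{signs} Σ_{m ∈ ℤ} ⟨m⟩⁻¹ ⟪n₁+n₂+n₃⟫⁻¹ (Π_j ⟪n_j⟫⁻¹) 1_{|κ₂−m|≤1}`. -/
def Lam (α : ℝ) (n₁ n₂ n₃ : Fin 3 → ℤ) : ℝ :=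
  ∑ e : Fin 4 → Bool,
    ∑' m : ℤ,
      (rjb (m : ℝ))⁻¹ * (jbb α (n₁ + n₂ + n₃))⁻¹ *
        ((jbb α n₁)⁻¹ * (jbb α n₂)⁻¹ * (jbb α n₃)⁻¹) *
        ind (|sgn (e 0) * jbb α (n₁ + n₂ + n₃) + sgn (e 1) * jbb α n₁ +
              sgn (e 2) * jbb α n₂ + sgn (e 3) * jbb α n₃ - (m : ℝ)| ≤ 1)

/-- A pairing of `{1, …, J}` (modelled on `Fin J`): anti-reflexive, symmetric and
univalent. -/
structure Pairing (J : ℕ) where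
  rel : Fin J → Fin J → Prop
  antirefl : ∀ j, ¬rel j j
  symm : ∀ i j, rel i j → rel j i
  univalent : ∀ i j j', rel i j → rel i j' → j = j'

/-- `j` is paired in `P`. -/
def Pairing.Paired {J : ℕ} (P : Pairing J) (j : Fin J) : Prop := ∃ i, P.rel j i

/-- `1 + |p + r w|²` along the line through `p` with direction `w`. -/
def lineSq (p w : Fin 3 → ℝ) (r : ℝ) : ℝ := 1 + ∑ i, (p i + r * w i) ^ 2

/-- The inner product of `p + r w` with `w`. -/
def lineDot (p w : Fin 3 → ℝ) (r : ℝ) : ℝ := ∑ i, (p i + r * w i) * w i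

/-- The derivative of `r ↦ ⟨p + r w⟩^α`. -/
def lineSlope (α : ℝ) (p w : Fin 3 → ℝ) (r : ℝ) : ℝ :=
  α * lineSq p w r ^ (α / 2 - 1) * lineDot p w r

lemma one_le_lineSq (p w : Fin 3 → ℝ) (r : ℝ) : 1 ≤ lineSq p w r := by
  have : 0 ≤ ∑ i, (p i + r * w i) ^ 2 := Finset.sum_nonneg fun i _ => sq_nonneg _
  unfold lineSq; linarith

lemma lineSq_pos (p w : Fin 3 → ℝ) (r : ℝ) : 0 < lineSq p w r :=
  lt_of_lt_of_le one_pos (one_le_lineSq p w r)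

lemma hasDerivAt_lineSq (p w : Fin 3 → ℝ) (r : ℝ) :
    HasDerivAt (lineSq p w) (2 * lineDot p w r) r := by
  unfold lineSq lineDot
  have h : ∀ i ∈ (Finset.univ : Finset (Fin 3)),
      HasDerivAt (fun r : ℝ => (p i + r * w i) ^ 2) (2 * ((p i + r * w i) * w i)) r := by
    intro i _
    have h1 : HasDerivAt (fun r : ℝ => p i + r * w i) (w i) r := by
      simpa using ((hasDerivAt_id r).mul_const (w i)).const_add (p i)
    have := h1.pow 2
    refine this.congr_deriv ?_
    simp; ring
  have := (HasDerivAt.fun_sum h).const_add 1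
  rwa [← Finset.mul_sum] at this

lemma hasDerivAt_lineDot (p w : Fin 3 → ℝ) (r : ℝ) :
    HasDerivAt (lineDot p w) (∑ i, w i ^ 2) r := by
  unfold lineDot
  refine HasDerivAt.fun_sum fun i _ => ?_
  have h1 : HasDerivAt (fun r : ℝ => p i + r * w i) (w i) r := by
    simpa using ((hasDerivAt_id r).mul_const (w i)).const_add (p i)
  refine (h1.mul_const (w i)).congr_deriv ?_
  ring

lemma lineDot_sq_le (p w : Fin 3 → ℝ) (r : ℝ) :
    lineDot p w r ^ 2 ≤ lineSq p w r * ∑ i, w i ^ 2 := by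
  have h1 := Finset.sum_mul_sq_le_sq_mul_sq Finset.univ (fun i => p i + r * w i) w
  have h2 : 0 ≤ ∑ i, w i ^ 2 := Finset.sum_nonneg fun i _ => sq_nonneg _
  unfold lineDot lineSq
  nlinarith

lemma hasDerivAt_lineSq_rpow (α : ℝ) (p w : Fin 3 → ℝ) (r : ℝ) :
    HasDerivAt (fun r => lineSq p w r ^ (α / 2)) (lineSlope α p w r) r := by
  refine ((hasDerivAt_lineSq p w r).rpow_const (Or.inl (lineSq_pos p w r).ne')).congr_deriv ?_
  unfold lineSlope
  ring

/-- Strong monotonicity of the slope of `⟨·⟩^α` along lines. -/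
lemma lineSlope_sub_ge {α : ℝ} (h1 : 1 < α) (h2 : α ≤ 2) (p w : Fin 3 → ℝ) {s t M : ℝ}
    (hst : s ≤ t) (hM : 0 < M) (hQ : ∀ r ∈ Set.Icc s t, lineSq p w r ≤ M ^ 2) :
    α * (α - 1) * (∑ i, w i ^ 2) * M ^ (α - 2) * (t - s)
      ≤ lineSlope α p w t - lineSlope α p w s := by
  have hd : ∀ r, HasDerivAt (lineSlope α p w)
      (α * (2 * lineDot p w r * (α / 2 - 1) * lineSq p w r ^ (α / 2 - 1 - 1)) * lineDot p w r
        + α * lineSq p w r ^ (α / 2 - 1) * ∑ i, w i ^ 2) r := by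
    intro r
    exact (((hasDerivAt_lineSq p w r).rpow_const
      (Or.inl (lineSq_pos p w r).ne')).const_mul α).mul (hasDerivAt_lineDot p w r)
  refine (convex_Icc s t).mul_sub_le_image_sub_of_le_deriv
    (fun r _ => (hd r).continuousAt.continuousWithinAt)
    (fun r _ => (hd r).differentiableAt.differentiableWithinAt) ?_ s
    (Set.left_mem_Icc.2 hst) t (Set.right_mem_Icc.2 hst) hst
  intro r hr
  rw [(hd r).deriv]
  have hq := lineSq_pos p w r
  have hw : 0 ≤ ∑ i, w i ^ 2 := Finset.sum_nonneg fun i _ => sq_nonneg _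
  have hM' : M ^ (α - 2) ≤ lineSq p w r ^ (α / 2 - 1) := by
    have e : M ^ (α - 2) = (M ^ 2) ^ (α / 2 - 1) := by
      rw [← Real.rpow_natCast, ← Real.rpow_mul hM.le]; congr 1; push_cast; ring
    rw [e]
    exact Real.rpow_le_rpow_of_nonpos hq (hQ r (interior_subset hr)) (by linarith)
  have hdot := lineDot_sq_le p w r
  have hs : lineSq p w r ^ (α / 2 - 1) = lineSq p w r ^ (α / 2 - 1 - 1) * lineSq p w r := by
    rw [← Real.rpow_add_one hq.ne']; congr 1; ring
  have hz : 0 < lineSq p w r ^ (α / 2 - 1 - 1) := Real.rpow_pos_of_pos hq _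
  have key : α * (α - 1) * (∑ i, w i ^ 2) * lineSq p w r ^ (α / 2 - 1) ≤
      α * (2 * lineDot p w r * (α / 2 - 1) * lineSq p w r ^ (α / 2 - 1 - 1)) * lineDot p w r
        + α * lineSq p w r ^ (α / 2 - 1) * ∑ i, w i ^ 2 := by
    rw [hs]
    have : 0 ≤ α * (2 - α) * lineSq p w r ^ (α / 2 - 1 - 1) *
        (lineSq p w r * ∑ i, w i ^ 2 - lineDot p w r ^ 2) :=
      mul_nonneg (mul_nonneg (mul_nonneg (by linarith) (by linarith)) hz.le) (by linarith)
    linarith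
  refine le_trans ?_ key
  exact mul_le_mul_of_nonneg_left hM' (mul_nonneg (mul_nonneg (by linarith) (by linarith)) hw)

lemma lineSlope_mono {α : ℝ} (h1 : 1 < α) (h2 : α ≤ 2) (p w : Fin 3 → ℝ) :
    Monotone (lineSlope α p w) := by
  intro s t hst
  obtain ⟨B, hB⟩ := isCompact_Icc.bddAbove_image (K := Set.Icc s t) (f := lineSq p w)
    (fun r _ => (hasDerivAt_lineSq p w r).continuousAt.continuousWithinAt)
  have hB1 : ∀ r ∈ Set.Icc s t, lineSq p w r ≤ B := fun r hr => hB ⟨r, hr, rfl⟩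
  have hBpos : 1 ≤ B := (one_le_lineSq p w s).trans (hB1 s (Set.left_mem_Icc.2 hst))
  have := lineSlope_sub_ge h1 h2 p w hst (M := B) (by linarith)
    (fun r hr => (hB1 r hr).trans (by nlinarith))
  have h0 : 0 ≤ α * (α - 1) * (∑ i, w i ^ 2) * B ^ (α - 2) * (t - s) := by
    have hw : 0 ≤ ∑ i, w i ^ 2 := Finset.sum_nonneg fun i _ => sq_nonneg _
    exact mul_nonneg (mul_nonneg (mul_nonneg (mul_nonneg (by linarith) (by linarith)) hw)
      (Real.rpow_nonneg (by linarith) _)) (by linarith)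
  linarith

/-- `⟨·⟩^α` lies above its tangents along lines. -/
lemma lineSlope_mul_le {α : ℝ} (h1 : 1 < α) (h2 : α ≤ 2) (p w : Fin 3 → ℝ) (s t : ℝ) :
    lineSlope α p w s * (t - s) ≤ lineSq p w t ^ (α / 2) - lineSq p w s ^ (α / 2) := by
  have hc : ConvexOn ℝ Set.univ (fun r => lineSq p w r ^ (α / 2)) := by
    refine MonotoneOn.convexOn_of_deriv convex_univ
      (fun r _ => (hasDerivAt_lineSq_rpow α p w r).continuousAt.continuousWithinAt)
      (fun r _ => (hasDerivAt_lineSq_rpow α p w r).differentiableAt.differentiableWithinAt) ?_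
    intro a _ b _ hab
    rw [(hasDerivAt_lineSq_rpow α p w a).deriv, (hasDerivAt_lineSq_rpow α p w b).deriv]
    exact lineSlope_mono h1 h2 p w hab
  rcases lt_trichotomy s t with h | h | h
  · have := hc.le_slope_of_hasDerivAt (Set.mem_univ s) (Set.mem_univ t) h
      (hasDerivAt_lineSq_rpow α p w s)
    rw [slope_def_field, le_div_iff₀ (by linarith)] at this
    linarith
  · subst h; simp
  · have := hc.slope_le_of_hasDerivAt (Set.mem_univ t) (Set.mem_univ s) h
      (hasDerivAt_lineSq_rpow α p w s)
    rw [slope_def_field, div_le_iff₀ (by linarith)] at this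
    linarith

/-- Japanese bracket on `ℝ³`. -/
def rb (x : Fin 3 → ℝ) : ℝ := Real.sqrt (1 + ∑ i, x i ^ 2)

lemma rb_sq (x : Fin 3 → ℝ) : rb x ^ 2 = 1 + ∑ i, x i ^ 2 :=
  Real.sq_sqrt (add_nonneg zero_le_one (Finset.sum_nonneg fun _ _ => sq_nonneg _))

lemma one_le_rb (x : Fin 3 → ℝ) : 1 ≤ rb x := by
  rw [rb, Real.one_le_sqrt]
  have : 0 ≤ ∑ i, x i ^ 2 := Finset.sum_nonneg fun i _ => sq_nonneg _
  linarith

lemma abs_le_rb (x : Fin 3 → ℝ) (i : Fin 3) : |x i| ≤ rb x := by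
  refine Real.abs_le_sqrt ?_
  have := Finset.single_le_sum (f := fun i => x i ^ 2) (fun i _ => sq_nonneg _)
    (Finset.mem_univ i)
  linarith

lemma abs_rb_sub_le (x y : Fin 3 → ℝ) : |rb x - rb y| ≤ ∑ i, |x i - y i| := by
  have hx := one_le_rb x
  have hy := one_le_rb y
  have h1 : (rb x - rb y) * (rb x + rb y) = ∑ i, (x i - y i) * (x i + y i) := by
    have : (rb x - rb y) * (rb x + rb y) = rb x ^ 2 - rb y ^ 2 := by ring
    rw [this, rb_sq, rb_sq, add_sub_add_left_eq_sub, ← Finset.sum_sub_distrib]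
    exact Finset.sum_congr rfl fun i _ => by ring
  have h2 : |rb x - rb y| * (rb x + rb y) ≤ (∑ i, |x i - y i|) * (rb x + rb y) := by
    rw [← abs_of_pos (show 0 < rb x + rb y by linarith), ← abs_mul, h1,
      abs_of_pos (show 0 < rb x + rb y by linarith), Finset.sum_mul]
    refine (Finset.abs_sum_le_sum_abs _ _).trans (Finset.sum_le_sum fun i _ => ?_)
    rw [abs_mul]
    exact mul_le_mul_of_nonneg_left
      ((abs_add_le _ _).trans (add_le_add (abs_le_rb x i) (abs_le_rb y i))) (abs_nonneg _)
  exact le_of_mul_le_mul_right h2 (by linarith)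

lemma abs_rpow_sub_rpow_le {α a b M : ℝ} (h1 : 1 < α) (ha : 1 ≤ a) (hb : 1 ≤ b)
    (haM : a ≤ M) (hbM : b ≤ M) : |a ^ α - b ^ α| ≤ α * M ^ (α - 1) * |a - b| := by
  have := (convex_Icc 1 M).norm_image_sub_le_of_norm_hasDerivWithin_le
    (f := fun x : ℝ => x ^ α) (f' := fun x => α * x ^ (α - 1)) (C := α * M ^ (α - 1))
    (fun x hx => (Real.hasDerivAt_rpow_const (Or.inr h1.le)).hasDerivWithinAt) (fun x hx => by
      have hx0 : 0 ≤ x := by linarith [hx.1]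
      rw [Real.norm_of_nonneg (mul_nonneg (by linarith) (Real.rpow_nonneg hx0 _))]
      exact mul_le_mul_of_nonneg_left (Real.rpow_le_rpow hx0 hx.2 (by linarith)) (by linarith))
    (⟨hb, hbM⟩ : b ∈ Set.Icc 1 M) (⟨ha, haM⟩ : a ∈ Set.Icc 1 M)
  simpa [Real.norm_eq_abs] using this

lemma rb_line_rpow (α : ℝ) (p w : Fin 3 → ℝ) (r : ℝ) :
    rb (fun i => p i + r * w i) ^ α = lineSq p w r ^ (α / 2) := by
  rw [rb, ← lineSq, Real.sqrt_eq_rpow, ← Real.rpow_mul (lineSq_pos p w r).le]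
  congr 1; ring

lemma rb_line_sq (p w : Fin 3 → ℝ) (r : ℝ) :
    rb (fun i => p i + r * w i) ^ 2 = lineSq p w r := rb_sq _

lemma jb_eq_rb (n : Fin 3 → ℤ) : jb n = rb (fun i => (n i : ℝ)) := rfl

lemma one_le_jb (n : Fin 3 → ℤ) : 1 ≤ jb n := one_le_rb _

lemma jb_pos (n : Fin 3 → ℤ) : 0 < jb n := lt_of_lt_of_le one_pos (one_le_jb n)

lemma abs_le_jb (n : Fin 3 → ℤ) (i : Fin 3) : |(n i : ℝ)| ≤ jb n :=
  abs_le_rb (fun i => (n i : ℝ)) i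

lemma jb_neg (n : Fin 3 → ℤ) : jb (-n) = jb n := by simp [jb]

lemma jb_add_le (m n : Fin 3 → ℤ) : jb (m + n) ≤ jb m + jb n := by
  have hm := one_le_jb m
  have hn := one_le_jb n
  refine Real.sqrt_le_iff.2 ⟨by linarith, ?_⟩
  have e1 : jb m ^ 2 = 1 + ∑ i, (m i : ℝ) ^ 2 := rb_sq _
  have e2 : jb n ^ 2 = 1 + ∑ i, (n i : ℝ) ^ 2 := rb_sq _
  have cs := Finset.sum_mul_sq_le_sq_mul_sq Finset.univ (fun i => (m i : ℝ)) (fun i => (n i : ℝ))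
  have h3 : ∑ i, (m i : ℝ) * n i ≤ jb m * jb n := by
    refine le_of_abs_le (abs_le_of_sq_le_sq ?_ (by nlinarith))
    rw [mul_pow, e1, e2]
    have h1 : 0 ≤ ∑ i, (m i : ℝ) ^ 2 := Finset.sum_nonneg fun i _ => sq_nonneg _
    have h2 : 0 ≤ ∑ i, (n i : ℝ) ^ 2 := Finset.sum_nonneg fun i _ => sq_nonneg _
    nlinarith
  have e3 : ∑ i, (((m + n) i : ℤ) : ℝ) ^ 2 =
      ∑ i, (m i : ℝ) ^ 2 + 2 * ∑ i, (m i : ℝ) * n i + ∑ i, (n i : ℝ) ^ 2 := by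
    rw [Finset.mul_sum, ← Finset.sum_add_distrib, ← Finset.sum_add_distrib]
    exact Finset.sum_congr rfl fun i _ => by push_cast [Pi.add_apply]; ring
  rw [e3]
  nlinarith

lemma one_le_jb_rpow {α : ℝ} (h : 0 ≤ α) (n : Fin 3 → ℤ) : 1 ≤ jb n ^ α :=
  Real.one_le_rpow (one_le_jb n) h

lemma jbb_le {α : ℝ} (h : 0 ≤ α) (n : Fin 3 → ℤ) : jbb α n ≤ jb n ^ α := by
  have h1 := one_le_jb_rpow h n
  refine Real.sqrt_le_iff.2 ⟨by linarith, ?_⟩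
  rw [← Real.rpow_mul_natCast (jb_pos n).le, mul_comm 2 α]
  norm_num

lemma le_jbb {α : ℝ} (h : 0 ≤ α) (n : Fin 3 → ℤ) : jb n ^ α - 1 / 2 ≤ jbb α n := by
  have h1 := one_le_jb_rpow h n
  refine Real.le_sqrt_of_sq_le ?_
  have : jb n ^ (2 * α) = (jb n ^ α) ^ 2 := by
    rw [← Real.rpow_mul_natCast (jb_pos n).le, mul_comm 2 α]; norm_num
  rw [this]
  nlinarith

lemma half_le_jbb {α : ℝ} (h : 0 ≤ α) (n : Fin 3 → ℤ) : jb n ^ α / 2 ≤ jbb α n := by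
  have h1 := one_le_jb_rpow h n
  have := le_jbb h n
  linarith

lemma jbb_pos {α : ℝ} (h : 0 ≤ α) (n : Fin 3 → ℤ) : 0 < jbb α n := by
  have h1 := one_le_jb_rpow h n
  have := le_jbb h n
  linarith

/-- The lattice points of the cube `[-R, R]³`. -/
def box (R : ℕ) : Finset (Fin 3 → ℤ) := Fintype.piFinset fun _ => Finset.Icc (-(R : ℤ)) R

lemma mem_box {R : ℕ} {z : Fin 3 → ℤ} : z ∈ box R ↔ ∀ i, |z i| ≤ R := by
  simp [box, abs_le]

lemma card_box (R : ℕ) : (box R).card = (2 * R + 1) ^ 3 := by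
  simp [box, Fintype.card_piFinset]
  omega

lemma card_le_of_sub_le (T : Finset ℤ) {B : ℝ} (hB : 0 ≤ B)
    (h : ∀ s ∈ T, ∀ t ∈ T, s ≤ t → ((t : ℝ) - s) ≤ B) : (T.card : ℝ) ≤ B + 1 := by
  rcases T.eq_empty_or_nonempty with rfl | hT
  · simp; linarith
  have hsub : T ⊆ Finset.Icc (T.min' hT) (T.max' hT) := fun t ht =>
    Finset.mem_Icc.2 ⟨T.min'_le t ht, T.le_max' t ht⟩
  have hle : T.min' hT ≤ T.max' hT := T.min'_le _ (T.max'_mem hT)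
  have h1 := h _ (T.min'_mem hT) _ (T.max'_mem hT) hle
  have h2 := Finset.card_le_card hsub
  rw [Int.card_Icc] at h2
  have h3 : (T.card : ℤ) ≤ T.max' hT + 1 - T.min' hT := by omega
  have h4 : (T.card : ℝ) ≤ T.max' hT + 1 - T.min' hT := by exact_mod_cast h3
  linarith

/-- Lower bound for the second difference of `⟨·⟩^α` along a line. -/
lemma lineSq_rpow_second_diff_ge {α : ℝ} (h1 : 1 < α) (h2 : α ≤ 2) (p w : Fin 3 → ℝ)
    {s t h M : ℝ} (hst : s ≤ t) (hh : 0 ≤ h) (hM : 0 < M)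
    (hQ : ∀ r ∈ Set.Icc s (t + h), lineSq p w r ≤ M ^ 2) :
    α * (α - 1) * (∑ i, w i ^ 2) * M ^ (α - 2) * h * (t - s)
      ≤ (lineSq p w (t + h) ^ (α / 2) - lineSq p w t ^ (α / 2))
        - (lineSq p w (s + h) ^ (α / 2) - lineSq p w s ^ (α / 2)) := by
  have hd : ∀ r, HasDerivAt
      (fun r => lineSq p w (r + h) ^ (α / 2) - lineSq p w r ^ (α / 2))
      (lineSlope α p w (r + h) - lineSlope α p w r) r := fun r =>
    ((hasDerivAt_lineSq_rpow α p w (r + h)).comp_add_const r h).sub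
      (hasDerivAt_lineSq_rpow α p w r)
  refine (convex_Icc s t).mul_sub_le_image_sub_of_le_deriv
    (f := fun r => lineSq p w (r + h) ^ (α / 2) - lineSq p w r ^ (α / 2))
    (fun r _ => (hd r).continuousAt.continuousWithinAt)
    (fun r _ => (hd r).differentiableAt.differentiableWithinAt) ?_ s
    (Set.left_mem_Icc.2 hst) t (Set.right_mem_Icc.2 hst) hst
  intro r hr
  have hr' := interior_subset hr
  rw [(hd r).deriv]
  have := lineSlope_sub_ge h1 h2 p w (s := r) (t := r + h) (by linarith) hM
    (fun x hx => hQ x ⟨hr'.1.trans hx.1, hx.2.trans (by linarith [hr'.2])⟩)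
  simpa using this

lemma abs_round_mul_le {R : ℕ} {t : ℤ} {w : ℝ} (ht : |t| ≤ R) (hw : |w| ≤ 1) :
    |round ((t : ℝ) * w)| ≤ R := by
  have h1 : |(t : ℝ) * w| ≤ R := by
    rw [abs_mul]
    have : |(t : ℝ)| ≤ R := by exact_mod_cast ht
    nlinarith [abs_nonneg (t : ℝ), abs_nonneg w]
  have h2 := abs_sub_round ((t : ℝ) * w)
  have h3 : |((round ((t : ℝ) * w) : ℤ) : ℝ)| ≤ R + 1 / 2 := by
    have := abs_sub_abs_le_abs_sub ((round ((t : ℝ) * w) : ℤ) : ℝ) ((t : ℝ) * w)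
    rw [abs_sub_comm] at this
    linarith
  have h4 : ((|round ((t : ℝ) * w)| : ℤ) : ℝ) < ((R + 1 : ℤ) : ℝ) := by
    push_cast; linarith
  have := Int.cast_lt.1 h4
  omega

/-- Replacing `⟪·⟫` by `⟨·⟩^α` costs a bounded error. -/
lemma abs_jb_rpow_sub_le {α : ℝ} (h : 0 ≤ α) {a b : Fin 3 → ℤ} {τ : ℝ}
    (hab : |jbb α a - jbb α b - τ| ≤ 1) : |jb a ^ α - jb b ^ α - τ| ≤ 2 := by
  have h1 := jbb_le h a
  have h2 := le_jbb h a
  have h3 := jbb_le h b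
  have h4 := le_jbb h b
  rw [abs_le] at *
  constructor <;> linarith [hab.1, hab.2]

lemma abs_jb_rpow_add_le {α : ℝ} (h : 0 ≤ α) {a b : Fin 3 → ℤ} {τ : ℝ}
    (hab : |jbb α a + jbb α b - τ| ≤ 1) : |jb a ^ α + jb b ^ α - τ| ≤ 2 := by
  have h1 := jbb_le h a
  have h2 := le_jbb h a
  have h3 := jbb_le h b
  have h4 := le_jbb h b
  rw [abs_le] at *
  constructor <;> linarith [hab.1, hab.2]

/-- A largest coordinate dominates the bracket. -/
lemma exists_max_coord (q : Fin 3 → ℤ) (hq : q ≠ 0) :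
    ∃ i, (∀ j, |(q j : ℝ)| ≤ |(q i : ℝ)|) ∧ 1 ≤ |(q i : ℝ)| ∧ jb q ≤ 2 * |(q i : ℝ)| := by
  obtain ⟨i, -, hi⟩ := Finset.exists_max_image Finset.univ (fun j => |(q j : ℝ)|)
    ⟨0, Finset.mem_univ _⟩
  have hi' : ∀ j, |(q j : ℝ)| ≤ |(q i : ℝ)| := fun j => hi j (Finset.mem_univ j)
  have hqi : 1 ≤ |(q i : ℝ)| := by
    have : q i ≠ 0 := by
      intro h0
      apply hq
      ext j
      have := hi' j
      rw [h0] at this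
      simpa using this
    exact_mod_cast Int.one_le_abs this
  refine ⟨i, hi', hqi, ?_⟩
  refine Real.sqrt_le_iff.2 ⟨by linarith, ?_⟩
  have : ∑ j, (q j : ℝ) ^ 2 ≤ ∑ _j : Fin 3, |(q i : ℝ)| ^ 2 :=
    Finset.sum_le_sum fun j _ => by
      rw [← sq_abs]; exact pow_le_pow_left₀ (abs_nonneg _) (hi' j) 2
  simp at this
  nlinarith [sq_abs (q i : ℝ)]

lemma rb_le_of_abs_le {x : Fin 3 → ℝ} {B : ℝ} (hB : 1 ≤ B) (hx : ∀ i, |x i| ≤ B) :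
    rb x ≤ 2 * B := by
  refine Real.sqrt_le_iff.2 ⟨by linarith, ?_⟩
  have : ∑ j, x j ^ 2 ≤ ∑ _j : Fin 3, B ^ 2 :=
    Finset.sum_le_sum fun j _ => by
      rw [← sq_abs]; exact pow_le_pow_left₀ (abs_nonneg _) (hx j) 2
  simp at this
  nlinarith

lemma card_box_le {R : ℕ} (hR : 1 ≤ R) : ((box R).card : ℝ) ≤ 27 * (R : ℝ) ^ 3 := by
  have : (1 : ℝ) ≤ R := by exact_mod_cast hR
  rw [card_box]
  push_cast
  calc (2 * (R : ℝ) + 1) ^ 3 ≤ (3 * (R : ℝ)) ^ 3 := by gcongr; linarith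
    _ = 27 * (R : ℝ) ^ 3 := by ring

/-- Along a sheared line in the direction of `q`, few points satisfy the resonance condition
for the difference. -/
lemma shear_line_sub_le {α : ℝ} (h1 : 1 < α) (h2 : α ≤ 2) {q y z z' : Fin 3 → ℤ} {R : ℕ}
    {i : Fin 3} (hR : 1 ≤ R) (hi : ∀ j, |(q j : ℝ)| ≤ |(q i : ℝ)|) (hqi : 1 ≤ |(q i : ℝ)|)
    (hz : z ∈ box R) (hz' : z' ∈ box R)
    (hy : ∀ j, z j - round ((z i : ℝ) * (q j / q i)) = y j)
    (hy' : ∀ j, z' j - round ((z' i : ℝ) * (q j / q i)) = y j) (hle : z i ≤ z' i) {τ : ℝ}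
    (hτ : |jb (z + q) ^ α - jb z ^ α - τ| ≤ 2) (hτ' : |jb (z' + q) ^ α - jb z' ^ α - τ| ≤ 2) :
    ((z' i : ℝ) - z i) ≤ 16 * (6 * R + 2 * |(q i : ℝ)|) / ((α - 1) * |(q i : ℝ)|) := by
  set w : Fin 3 → ℝ := fun j => q j / q i with hw
  set p : Fin 3 → ℝ := fun j => (y j : ℝ) with hp
  set M : ℝ := 6 * R + 2 * |(q i : ℝ)| with hM
  have hRR : (1 : ℝ) ≤ R := by exact_mod_cast hR
  have hM1 : 1 ≤ M := by rw [hM]; linarith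
  have hqi0 : (q i : ℝ) ≠ 0 := by
    intro h; rw [h] at hqi; norm_num at hqi
  have hw1 : ∀ j, |w j| ≤ 1 := fun j => by
    rw [hw]; simp only; rw [abs_div]; exact div_le_one_of_le₀ (hi j) (abs_nonneg _)
  have hwi : w i = 1 := div_self hqi0
  have hwq : ∀ j, (q i : ℝ) * w j = q j := fun j => by rw [hw]; field_simp
  have hzR := mem_box.1 hz
  have hzR' := mem_box.1 hz'
  have hpR : ∀ j, |p j| ≤ 2 * R := by
    intro j
    have ha : |y j| ≤ 2 * R := by
      rw [← hy j]
      have := abs_round_mul_le (hzR i) (hw1 j)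
      have h3 := hzR j
      refine (abs_sub _ _).trans ?_
      have e : |round ((z i : ℝ) * (q j / q i))| ≤ R := this
      omega
    change |((y j : ℤ) : ℝ)| ≤ 2 * R
    exact_mod_cast ha
  have hQ0 : ∀ r : ℝ, |r| ≤ R + |(q i : ℝ)| → rb (fun j => p j + r * w j) ≤ M := by
    intro r hr
    have : rb (fun j => p j + r * w j) ≤ 2 * (3 * R + |(q i : ℝ)|) := by
      refine rb_le_of_abs_le (by linarith) fun j => ?_
      refine (abs_add_le _ _).trans ?_
      rw [abs_mul]
      have := mul_le_mul hr (hw1 j) (abs_nonneg _) (by linarith)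
      linarith [hpR j]
    rw [hM]; linarith
  have hQ : ∀ r : ℝ, |r| ≤ R + |(q i : ℝ)| → lineSq p w r ≤ M ^ 2 := fun r hr => by
    rw [← rb_line_sq]
    exact pow_le_pow_left₀ (by linarith [one_le_rb (fun j => p j + r * w j)]) (hQ0 r hr) 2
  -- comparison of the lattice points with the points of the line
  have near : ∀ x : Fin 3 → ℤ, x ∈ box R →
      (∀ j, x j - round ((x i : ℝ) * (q j / q i)) = y j) →
      |jb (x + q) ^ α - lineSq p w (x i + q i) ^ (α / 2)| ≤ 3 * M ^ (α - 1) ∧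
      |jb x ^ α - lineSq p w (x i) ^ (α / 2)| ≤ 3 * M ^ (α - 1) := by
    intro x hx hxy
    have hxR := mem_box.1 hx
    have hxR' : ∀ j, |(x j : ℝ)| ≤ R := fun j => by exact_mod_cast hxR j
    have hdist : ∀ j, |(x j : ℝ) - (p j + x i * w j)| ≤ 1 / 2 := by
      intro j
      have e : (x j : ℝ) - (p j + x i * w j) =
          ((round ((x i : ℝ) * (q j / q i)) : ℤ) : ℝ) - (x i : ℝ) * (q j / q i) := by
        rw [hp, hw]; simp only; rw [← hxy j]; push_cast; ring
      rw [e, abs_sub_comm]; exact abs_sub_round _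
    have bnd : ∀ (u v : Fin 3 → ℝ), rb u ≤ M → rb v ≤ M → (∀ j, |u j - v j| ≤ 1 / 2) →
        |rb u ^ α - rb v ^ α| ≤ 3 * M ^ (α - 1) := by
      intro u v hu hv huv
      refine (abs_rpow_sub_rpow_le h1 (one_le_rb u) (one_le_rb v) hu hv).trans ?_
      have s1 : |rb u - rb v| ≤ 3 / 2 := by
        refine (abs_rb_sub_le u v).trans ((Finset.sum_le_sum fun j _ => huv j).trans ?_)
        simp; norm_num
      have s2 : 0 ≤ M ^ (α - 1) := Real.rpow_nonneg (by linarith) _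
      calc α * M ^ (α - 1) * |rb u - rb v| ≤ 2 * M ^ (α - 1) * (3 / 2) := by gcongr
        _ = 3 * M ^ (α - 1) := by ring
    constructor
    · rw [← rb_line_rpow, jb_eq_rb]
      refine bnd _ _ ?_ (hQ0 _ ((abs_add_le _ _).trans (by linarith [hxR' i]))) fun j => ?_
      · refine (rb_le_of_abs_le (B := R + |(q i : ℝ)|) (by linarith) fun j => ?_).trans ?_
        · push_cast [Pi.add_apply]
          exact (abs_add_le _ _).trans (add_le_add (hxR' j) (hi j))
        · rw [hM]; linarith
      · have : (((x + q) j : ℤ) : ℝ) - (p j + ((x i : ℝ) + q i) * w j) =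
            (x j : ℝ) - (p j + x i * w j) := by
          push_cast [Pi.add_apply]; rw [add_mul, hwq j]; ring
        rw [this]; exact hdist j
    · rw [← rb_line_rpow, jb_eq_rb]
      refine bnd _ _ ?_ (hQ0 _ (by linarith [hxR' i])) hdist
      refine (rb_le_of_abs_le (B := R) (by linarith) hxR').trans ?_
      rw [hM]; linarith
  obtain ⟨n1, n2⟩ := near z hz hy
  obtain ⟨n3, n4⟩ := near z' hz' hy'
  have hMp : 1 ≤ M ^ (α - 1) := Real.one_le_rpow hM1 (by linarith)
  have hup : |(lineSq p w (z' i + q i) ^ (α / 2) - lineSq p w (z' i) ^ (α / 2)) -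
      (lineSq p w (z i + q i) ^ (α / 2) - lineSq p w (z i) ^ (α / 2))| ≤ 16 * M ^ (α - 1) := by
    rw [abs_le] at *
    constructor <;> linarith [n1.1, n1.2, n2.1, n2.2, n3.1, n3.2, n4.1, n4.2, hτ.1, hτ.2,
      hτ'.1, hτ'.2]
  have hzi : |(z i : ℝ)| ≤ R := by exact_mod_cast hzR i
  have hzi' : |(z' i : ℝ)| ≤ R := by exact_mod_cast hzR' i
  have hle' : (z i : ℝ) ≤ z' i := by exact_mod_cast hle
  have hw2 : 1 ≤ ∑ j, w j ^ 2 := by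
    have := Finset.single_le_sum (f := fun j => w j ^ 2) (fun j _ => sq_nonneg _)
      (Finset.mem_univ i)
    simpa [hwi] using this
  have hlow : α * (α - 1) * (∑ j, w j ^ 2) * M ^ (α - 2) * |(q i : ℝ)| * (z' i - z i) ≤
      16 * M ^ (α - 1) := by
    refine le_trans ?_ hup
    rw [abs_le] at hzi hzi'
    rcases le_total 0 (q i : ℝ) with hpos | hneg
    · rw [abs_of_nonneg hpos] at hQ ⊢
      refine (lineSq_rpow_second_diff_ge h1 h2 p w hle' hpos (by linarith) fun r hr =>
        hQ r ?_).trans (le_abs_self _)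
      rw [abs_le]; constructor <;> linarith [hr.1, hr.2]
    · rw [abs_of_nonpos hneg] at hQ ⊢
      have := lineSq_rpow_second_diff_ge h1 h2 p w (s := z i + q i) (t := z' i + q i)
        (h := -(q i)) (M := M) (by linarith) (by linarith) (by linarith) fun r hr => hQ r (by
          rw [abs_le]; constructor <;> linarith [hr.1, hr.2])
      refine le_trans (le_of_eq_of_le ?_ this) (le_trans (le_of_eq ?_) (neg_le_abs _))
      · ring
      · rw [add_neg_cancel_right, add_neg_cancel_right]; ring
  have hMe : M ^ (α - 1) = M ^ (α - 2) * M := by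
    rw [← Real.rpow_add_one (by linarith)]; congr 1; ring
  have hMp2 : 0 < M ^ (α - 2) := Real.rpow_pos_of_pos (by linarith) _
  rw [le_div_iff₀ (mul_pos (by linarith) (by linarith))]
  refine le_of_mul_le_mul_left ?_ hMp2
  have hA : 1 ≤ α * ∑ j, w j ^ 2 := by nlinarith
  have hB : 0 ≤ M ^ (α - 2) * (((z' i : ℝ) - z i) * ((α - 1) * |(q i : ℝ)|)) :=
    mul_nonneg hMp2.le (mul_nonneg (by linarith) (mul_nonneg (by linarith) (abs_nonneg _)))
  calc M ^ (α - 2) * (((z' i : ℝ) - z i) * ((α - 1) * |(q i : ℝ)|))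
      ≤ (α * ∑ j, w j ^ 2) * (M ^ (α - 2) * (((z' i : ℝ) - z i) * ((α - 1) * |(q i : ℝ)|))) :=
        le_mul_of_one_le_left hB hA
    _ = α * (α - 1) * (∑ j, w j ^ 2) * M ^ (α - 2) * |(q i : ℝ)| * (z' i - z i) := by ring
    _ ≤ 16 * M ^ (α - 1) := hlow
    _ = M ^ (α - 2) * (16 * M) := by rw [hMe]; ring

lemma card_le_sum_of_fiber_le {β γ : Type*} [DecidableEq γ] {s : Finset β} {t : Finset γ}
    {φ : β → γ} {K : γ → ℝ} (hm : ∀ x ∈ s, φ x ∈ t)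
    (hK : ∀ b ∈ t, ((s.filter fun x => φ x = b).card : ℝ) ≤ K b) :
    (s.card : ℝ) ≤ ∑ b ∈ t, K b := by
  rw [Finset.card_eq_sum_card_fiberwise (f := φ) (t := t) hm]
  push_cast
  exact Finset.sum_le_sum hK

/-- The lattice points of `[-R, R]³` in the coordinate plane orthogonal to `e_i`. -/
def slab (i : Fin 3) (R : ℕ) : Finset (Fin 3 → ℤ) :=
  Fintype.piFinset fun j => if j = i then {0} else Finset.Icc (-(R : ℤ)) R

lemma mem_slab {i : Fin 3} {R : ℕ} {y : Fin 3 → ℤ} :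
    y ∈ slab i R ↔ y i = 0 ∧ ∀ j, j ≠ i → |y j| ≤ R := by
  simp only [slab, Fintype.mem_piFinset]
  constructor
  · intro h
    refine ⟨by simpa using h i, fun j hj => ?_⟩
    have := h j
    rw [if_neg hj] at this
    simpa [abs_le] using this
  · rintro ⟨h0, h⟩ j
    by_cases hj : j = i
    · subst hj; simp [h0]
    · rw [if_neg hj]; simpa [abs_le] using h j hj

lemma card_slab (i : Fin 3) (R : ℕ) : (slab i R).card = (2 * R + 1) ^ 2 := by
  have e : (Finset.Icc (-(R : ℤ)) R).card = 2 * R + 1 := by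
    rw [Int.card_Icc]; omega
  rw [slab, Fintype.card_piFinset, Fin.prod_univ_three]
  fin_cases i <;> simp [e, sq]

lemma card_slab_le (i : Fin 3) {R : ℕ} (hR : 1 ≤ R) :
    ((slab i R).card : ℝ) ≤ 9 * (R : ℝ) ^ 2 := by
  have : (1 : ℝ) ≤ R := by exact_mod_cast hR
  rw [card_slab]
  push_cast
  calc (2 * (R : ℝ) + 1) ^ 2 ≤ (3 * (R : ℝ)) ^ 2 := by gcongr; linarith
    _ = 9 * (R : ℝ) ^ 2 := by ring

/-- Counting estimate for opposite signs. -/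
lemma card_resonant_sub_le {α : ℝ} (h1 : 1 < α) (h2 : α ≤ 2) :
    ∃ C : ℝ, 0 < C ∧ ∀ (q : Fin 3 → ℤ) (R : ℕ) (τ : ℝ), 1 ≤ R →
      (((box R).filter fun z => |jbb α (z + q) - jbb α z - τ| ≤ 1).card : ℝ)
        ≤ C * ((R : ℝ) ^ 2 + (R : ℝ) ^ 3 / jb q) := by
  have hα : 0 < α - 1 := by linarith
  refine ⟨36 * (1 + 224 / (α - 1)), by positivity, fun q R τ hR => ?_⟩
  have hRR : (1 : ℝ) ≤ R := by exact_mod_cast hR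
  by_cases hq : q = 0
  · have e : jb q = 1 := by simp [hq, jb]
    rw [e, div_one]
    have hc : (((box R).filter fun z => |jbb α (z + q) - jbb α z - τ| ≤ 1).card : ℝ)
        ≤ 27 * (R : ℝ) ^ 3 :=
      le_trans (by exact_mod_cast Finset.card_filter_le _ _) (card_box_le hR)
    have : 0 ≤ 224 / (α - 1) := by positivity
    have h3 : 0 ≤ (R : ℝ) ^ 3 := by positivity
    have h4 : 0 ≤ (R : ℝ) ^ 2 := by positivity
    nlinarith [mul_nonneg this h3, mul_nonneg this h4]
  obtain ⟨i, hi, hqi, hjq⟩ := exists_max_coord q hq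
  set K : ℝ := 16 * (6 * R + 2 * |(q i : ℝ)|) / ((α - 1) * |(q i : ℝ)|) with hK
  have hK0 : 0 ≤ K := by positivity
  have hmain : (((box R).filter fun z => |jbb α (z + q) - jbb α z - τ| ≤ 1).card : ℝ)
      ≤ ∑ _y ∈ slab i (2 * R), (K + 1) := by
    refine card_le_sum_of_fiber_le
      (φ := fun z j => z j - round ((z i : ℝ) * (q j / q i))) ?_ ?_
    · intro z hz
      have hzR := mem_box.1 (Finset.mem_filter.1 hz).1
      have hqi0 : (q i : ℝ) ≠ 0 := by
        intro h; rw [h] at hqi; norm_num at hqi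
      refine mem_slab.2 ⟨by simp [div_self hqi0], fun j _ => ?_⟩
      have ha : |round ((z i : ℝ) * (q j / q i))| ≤ R := by
        refine abs_round_mul_le (hzR i) ?_
        rw [abs_div]; exact div_le_one_of_le₀ (hi j) (abs_nonneg _)
      refine (abs_sub _ _).trans ?_
      have := hzR j
      push_cast
      omega
    · intro y _
      rw [Finset.filter_filter]
      set F := (box R).filter fun z => |jbb α (z + q) - jbb α z - τ| ≤ 1 ∧
        (fun j => z j - round ((z i : ℝ) * (q j / q i))) = y with hF
      have hinj : Set.InjOn (fun z : Fin 3 → ℤ => z i) F := by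
        intro z hz z' hz' h
        have hz1 := (Finset.mem_filter.1 hz).2.2
        have hz2 := (Finset.mem_filter.1 hz').2.2
        ext j
        have e1 := congrFun hz1 j
        have e2 := congrFun hz2 j
        simp only at e1 e2 h
        rw [h] at e1
        omega
      rw [← Finset.card_image_of_injOn hinj]
      refine card_le_of_sub_le _ hK0 ?_
      intro s hs t ht hst
      obtain ⟨z, hz, rfl⟩ := Finset.mem_image.1 hs
      obtain ⟨z', hz', rfl⟩ := Finset.mem_image.1 ht
      obtain ⟨a1, a2, a3⟩ := Finset.mem_filter.1 hz
      obtain ⟨b1, b2, b3⟩ := Finset.mem_filter.1 hz'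
      exact shear_line_sub_le h1 h2 hR hi hqi a1 b1 (fun j => congrFun a3 j)
        (fun j => congrFun b3 j) hst (abs_jb_rpow_sub_le (by linarith) a2)
        (abs_jb_rpow_sub_le (by linarith) b2)
  refine hmain.trans ?_
  rw [Finset.sum_const, nsmul_eq_mul]
  have hs := card_slab_le i (R := 2 * R) (by omega)
  push_cast at hs
  have hKle : K ≤ (192 * (R / jb q) + 32) / (α - 1) := by
    have hj := jb_pos q
    rw [hK, div_le_div_iff₀ (by positivity) hα]
    have : (R : ℝ) ≤ 2 * (R / jb q) * |(q i : ℝ)| := by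
      rw [mul_assoc, div_mul_eq_mul_div, mul_div_assoc', le_div_iff₀ hj]
      nlinarith
    nlinarith
  have hX : 0 ≤ (R : ℝ) / jb q := div_nonneg (by linarith) (jb_pos q).le
  calc ((slab i (2 * R)).card : ℝ) * (K + 1) ≤ (36 * (R : ℝ) ^ 2) * (K + 1) := by
        gcongr; linarith
    _ ≤ (36 * (R : ℝ) ^ 2) * ((192 * (R / jb q) + 32) / (α - 1) + 1) := by gcongr
    _ ≤ (36 * (R : ℝ) ^ 2) * ((1 + 224 / (α - 1)) * (1 + R / jb q)) := by
        gcongr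
        have : 0 ≤ 1 / (α - 1) := by positivity
        have e1 : (192 * (R / jb q) + 32) / (α - 1) =
          (192 * (R / jb q) + 32) * (1 / (α - 1)) := by ring
        have e2 : 224 / (α - 1) = 224 * (1 / (α - 1)) := by ring
        rw [e1, e2]
        nlinarith [mul_nonneg this hX]
    _ = 36 * (1 + 224 / (α - 1)) * ((R : ℝ) ^ 2 + (R : ℝ) ^ 3 / jb q) := by ring

/-- The gradient of `⟨·⟩^α` on `ℝ³`. -/
def gradJb (α : ℝ) (x : Fin 3 → ℝ) (j : Fin 3) : ℝ := α * rb x ^ (α - 2) * x j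

lemma lineSlope_eq (α : ℝ) (p w : Fin 3 → ℝ) (r : ℝ) :
    lineSlope α p w r = ∑ j, gradJb α (fun j => p j + r * w j) j * w j := by
  have e : lineSq p w r ^ (α / 2 - 1) = rb (fun j => p j + r * w j) ^ (α - 2) := by
    rw [rb_line_rpow]; congr 1; ring
  unfold lineSlope gradJb lineDot
  rw [e, Finset.mul_sum]
  exact Finset.sum_congr rfl fun j _ => by ring

lemma gradJb_add_ge {α : ℝ} (h1 : 1 < α) (h2 : α ≤ 2) {a b : Fin 3 → ℝ} {B : ℝ} (hB : 1 ≤ B)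
    (ha : ∀ j, |a j| ≤ B) (hb : ∀ j, |b j| ≤ B) :
    α * (α - 1) * (∑ j, (a j + b j) ^ 2) * (2 * B) ^ (α - 2)
      ≤ ∑ j, (gradJb α a j + gradJb α b j) * (a j + b j) := by
  have := lineSlope_sub_ge h1 h2 (fun j => -b j) (fun j => a j + b j) (s := 0) (t := 1)
    (M := 2 * B) zero_le_one (by linarith) (fun r hr => by
      rw [← rb_line_sq]
      refine pow_le_pow_left₀ (zero_le_one.trans (one_le_rb _))
        (rb_le_of_abs_le hB fun j => ?_) 2
      have e : -b j + r * (a j + b j) = (1 - r) * (-b j) + r * a j := by ring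
      rw [e]
      refine (abs_add_le _ _).trans ?_
      rw [abs_mul, abs_mul, abs_of_nonneg hr.1, abs_of_nonneg (sub_nonneg.2 hr.2), abs_neg]
      nlinarith [ha j, hb j, hr.1, hr.2])
  rw [lineSlope_eq, lineSlope_eq, ← Finset.sum_sub_distrib] at this
  simp only [sub_zero, mul_one] at this
  refine this.trans (le_of_eq (Finset.sum_congr rfl fun j _ => ?_))
  have e1 : (fun j => -b j + 1 * (a j + b j)) = a := by ext j; ring
  have e2 : rb (fun j => -b j + 0 * (a j + b j)) = rb b := by simp [rb]
  rw [e1]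
  unfold gradJb
  rw [e2]
  ring

/-- Some partial derivative of `⟨·+q⟩^α + ⟨·⟩^α` is large. -/
lemma exists_gradJb_add_ge {α : ℝ} (h1 : 1 < α) (h2 : α ≤ 2) {a b : Fin 3 → ℝ} {B : ℝ}
    (hB : 1 ≤ B) (ha : ∀ j, |a j| ≤ B) (hb : ∀ j, |b j| ≤ B) :
    ∃ i, ∀ j, (α - 1) / 3 * (2 * B) ^ (α - 2) * |a j + b j| ≤ |gradJb α a i + gradJb α b i| := by
  obtain ⟨k, -, hk⟩ := Finset.exists_max_image Finset.univ (fun j => |a j + b j|)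
    ⟨0, Finset.mem_univ _⟩
  obtain ⟨i, -, hi⟩ := Finset.exists_max_image Finset.univ
    (fun j => |gradJb α a j + gradJb α b j|) ⟨0, Finset.mem_univ _⟩
  have hP : 0 < (2 * B) ^ (α - 2) := Real.rpow_pos_of_pos (by linarith) _
  refine ⟨i, fun j => ?_⟩
  refine (mul_le_mul_of_nonneg_left (hk j (Finset.mem_univ _))
    (mul_nonneg (by linarith) hP.le)).trans ?_
  rcases (abs_nonneg (a k + b k)).eq_or_lt with h0 | h0
  · rw [← h0]; simp
  have hg := gradJb_add_ge h1 h2 hB ha hb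
  have up : ∑ j, (gradJb α a j + gradJb α b j) * (a j + b j) ≤
      3 * (|gradJb α a i + gradJb α b i| * |a k + b k|) := by
    calc ∑ j, (gradJb α a j + gradJb α b j) * (a j + b j)
        ≤ ∑ _j : Fin 3, |gradJb α a i + gradJb α b i| * |a k + b k| :=
          Finset.sum_le_sum fun j _ => (le_abs_self _).trans (by
            rw [abs_mul]
            exact mul_le_mul (hi j (Finset.mem_univ _)) (hk j (Finset.mem_univ _))
              (abs_nonneg _) (abs_nonneg _))
      _ = _ := by simp
  have low : |a k + b k| ^ 2 ≤ ∑ j, (a j + b j) ^ 2 := by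
    have := Finset.single_le_sum (f := fun j => (a j + b j) ^ 2) (fun j _ => sq_nonneg _)
      (Finset.mem_univ k)
    simpa using this
  refine le_of_mul_le_mul_right ?_ h0
  have hc : 0 ≤ (α - 1) * (2 * B) ^ (α - 2) := mul_nonneg (by linarith) hP.le
  have h3 : (α - 1) * (2 * B) ^ (α - 2) * |a k + b k| ^ 2 ≤
      α * (α - 1) * (∑ j, (a j + b j) ^ 2) * (2 * B) ^ (α - 2) := by
    calc (α - 1) * (2 * B) ^ (α - 2) * |a k + b k| ^ 2
        ≤ (α - 1) * (2 * B) ^ (α - 2) * ∑ j, (a j + b j) ^ 2 :=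
          mul_le_mul_of_nonneg_left low hc
      _ ≤ α * ((α - 1) * (2 * B) ^ (α - 2) * ∑ j, (a j + b j) ^ 2) :=
          le_mul_of_one_le_left (mul_nonneg hc (Finset.sum_nonneg fun _ _ => sq_nonneg _)) h1.le
      _ = _ := by ring
  nlinarith

/-- Convexity of `⟨·⟩^α` between lattice points on a coordinate line. -/
lemma gradJb_mul_le {α : ℝ} (h1 : 1 < α) (h2 : α ≤ 2) {z z' : Fin 3 → ℤ} {i : Fin 3}
    (h : ∀ j, j ≠ i → z j = z' j) :
    gradJb α (fun j => (z j : ℝ)) i * ((z' i : ℝ) - z i) ≤ jb z' ^ α - jb z ^ α := by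
  have := lineSlope_mul_le h1 h2 (fun j => (z j : ℝ)) (Pi.single i 1) 0 ((z' i : ℝ) - z i)
  rw [lineSlope_eq, ← rb_line_rpow, ← rb_line_rpow] at this
  have e1 : (fun j => (z j : ℝ) + ((z' i : ℝ) - z i) * (Pi.single i 1 : Fin 3 → ℝ) j) =
      fun j => (z' j : ℝ) := by
    ext j
    by_cases hj : j = i
    · subst hj; simp
    · simp [hj, h j hj]
  have e2 : (fun j => (z j : ℝ) + 0 * (Pi.single i 1 : Fin 3 → ℝ) j) = fun j => (z j : ℝ) := by
    ext j; ring
  rw [e1, e2, ← jb_eq_rb, ← jb_eq_rb] at this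
  simpa [Pi.single_apply] using this

/-- Few points of a coordinate line satisfy the resonance condition for the sum and have a
large partial derivative. -/
lemma card_line_add_le {α : ℝ} (h1 : 1 < α) (h2 : α ≤ 2) {q : Fin 3 → ℤ} {i : Fin 3} {lam τ : ℝ}
    (hlam : 0 < lam) (F : Finset (Fin 3 → ℤ))
    (hline : ∀ z ∈ F, ∀ z' ∈ F, ∀ j, j ≠ i → z j = z' j)
    (hτ : ∀ z ∈ F, |jb (z + q) ^ α + jb z ^ α - τ| ≤ 2)
    (hgrad : ∀ z ∈ F, lam ≤ |gradJb α (fun j => ((z + q) j : ℝ)) i +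
      gradJb α (fun j => (z j : ℝ)) i|) :
    (F.card : ℝ) ≤ 2 * (4 / lam + 1) := by
  have hinj : Set.InjOn (fun z : Fin 3 → ℤ => z i) F := by
    intro z hz z' hz' h
    ext j
    by_cases hj : j = i
    · subst hj; exact h
    · exact hline z hz z' hz' j hj
  have hconv : ∀ z ∈ F, ∀ z' ∈ F, (gradJb α (fun j => ((z + q) j : ℝ)) i +
      gradJb α (fun j => (z j : ℝ)) i) * ((z' i : ℝ) - z i) ≤ 4 := by
    intro z hz z' hz'
    have c1 := gradJb_mul_le h1 h2 (hline z hz z' hz')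
    have c2 := gradJb_mul_le h1 h2 (z := z + q) (z' := z' + q) (i := i) (fun j hj => by
      simp [hline z hz z' hz' j hj])
    have e : (((z' + q) i : ℤ) : ℝ) - (((z + q) i : ℤ) : ℝ) = (z' i : ℝ) - z i := by
      push_cast [Pi.add_apply]; ring
    rw [e] at c2
    have t1 := abs_le.1 (hτ z hz)
    have t2 := abs_le.1 (hτ z' hz')
    rw [add_mul]
    linarith [t1.1, t2.2]
  classical
  set G : (Fin 3 → ℤ) → ℝ := fun z => gradJb α (fun j => ((z + q) j : ℝ)) i +
      gradJb α (fun j => (z j : ℝ)) i with hG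
  have hpart : ∀ F' ⊆ F, ((∀ z ∈ F', lam ≤ G z) ∨ (∀ z ∈ F', G z ≤ -lam)) →
      (F'.card : ℝ) ≤ 4 / lam + 1 := by
    intro F' hF' hs
    rw [← Finset.card_image_of_injOn (hinj.mono hF')]
    refine card_le_of_sub_le _ (by positivity) ?_
    intro s hs' t ht hst
    obtain ⟨z, hz, rfl⟩ := Finset.mem_image.1 hs'
    obtain ⟨z', hz', rfl⟩ := Finset.mem_image.1 ht
    have hst' : (z i : ℝ) ≤ z' i := by exact_mod_cast hst
    rw [le_div_iff₀ hlam]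
    rcases hs with hs | hs
    · have := hconv z (hF' hz) z' (hF' hz')
      have := hs z hz
      nlinarith
    · have := hconv z' (hF' hz') z (hF' hz)
      have := hs z' hz'
      nlinarith
  have hsplit := Finset.card_filter_add_card_filter_not (s := F) (fun z => 0 ≤ G z)
  have p1 := hpart (F.filter fun z => 0 ≤ G z) (Finset.filter_subset _ _)
    (Or.inl fun z hz => by
      obtain ⟨hzF, hz0⟩ := Finset.mem_filter.1 hz
      have := hgrad z hzF
      rwa [abs_of_nonneg hz0] at this)
  have p2 := hpart (F.filter fun z => ¬ 0 ≤ G z) (Finset.filter_subset _ _)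
    (Or.inr fun z hz => by
      obtain ⟨hzF, hz0⟩ := Finset.mem_filter.1 hz
      have := hgrad z hzF
      rw [abs_of_neg (not_le.1 hz0)] at this
      linarith)
  have : (F.card : ℝ) = ((F.filter fun z => 0 ≤ G z).card : ℝ) +
      ((F.filter fun z => ¬ 0 ≤ G z).card : ℝ) := by exact_mod_cast hsplit.symm
  linarith

lemma sum_inv_sqrt_le (L : ℕ) :
    ∑ m ∈ Finset.Icc (-(L : ℤ)) L, 1 / Real.sqrt (1 + |(m : ℝ)|) ≤ 4 * Real.sqrt (L + 1) := by
  induction L with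
  | zero => simp
  | succ L ih =>
    have e : Finset.Icc (-((L + 1 : ℕ) : ℤ)) ((L + 1 : ℕ) : ℤ) =
        insert (-((L : ℤ) + 1)) (insert ((L : ℤ) + 1) (Finset.Icc (-(L : ℤ)) L)) := by
      ext x; simp; omega
    rw [e, Finset.sum_insert (by simp; omega), Finset.sum_insert (by simp)]
    have a1 : |((-((L : ℤ) + 1) : ℤ) : ℝ)| = L + 1 := by
      push_cast; rw [abs_of_nonpos (by linarith [(Nat.cast_nonneg L : (0 : ℝ) ≤ L)])]; ring
    have a2 : |(((L : ℤ) + 1 : ℤ) : ℝ)| = L + 1 := by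
      push_cast; rw [abs_of_nonneg (by positivity)]
    rw [a1, a2]
    push_cast
    have hx : (0 : ℝ) < 1 + (L + 1) := by positivity
    set x := Real.sqrt (1 + ((L : ℝ) + 1)) with hxd
    set y := Real.sqrt ((L : ℝ) + 1) with hyd
    have hxs : x ^ 2 = 1 + (L + 1) := Real.sq_sqrt hx.le
    have hys : y ^ 2 = L + 1 := Real.sq_sqrt (by positivity)
    have hxp : 0 < x := Real.sqrt_pos.2 hx
    have hyp : 0 ≤ y := Real.sqrt_nonneg _
    have e3 : Real.sqrt ((L : ℝ) + 1 + 1) = x := by rw [hxd]; congr 1; ring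
    rw [e3]
    have key : 1 / x ≤ 2 * (x - y) := by
      rw [div_le_iff₀ hxp]
      nlinarith [sq_nonneg (x - y)]
    linarith

lemma sum_inv_sqrt_affine_le {R : ℕ} (hR : 1 ≤ R) {q : ℤ} (hq : |q| ≤ 4 * R) :
    ∑ k ∈ Finset.Icc (-(R : ℤ)) R, 1 / Real.sqrt (1 + |2 * (k : ℝ) + q|)
      ≤ 4 * Real.sqrt (7 * R) := by
  have hRR : (1 : ℝ) ≤ R := by exact_mod_cast hR
  have h1 : ∑ k ∈ Finset.Icc (-(R : ℤ)) R, 1 / Real.sqrt (1 + |2 * (k : ℝ) + q|) =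
      ∑ m ∈ (Finset.Icc (-(R : ℤ)) R).image (fun k => 2 * k + q),
        1 / Real.sqrt (1 + |(m : ℝ)|) := by
    rw [Finset.sum_image (fun a _ b _ h => by have h1 : 2 * a + q = 2 * b + q := h; omega)]
    push_cast; rfl
  rw [h1]
  refine (Finset.sum_le_sum_of_subset_of_nonneg (t := Finset.Icc (-((6 * R : ℕ) : ℤ)) (6 * R : ℕ))
    ?_ (fun _ _ _ => by positivity)).trans ((sum_inv_sqrt_le (6 * R)).trans ?_)
  · intro m hm
    obtain ⟨k, hk, rfl⟩ := Finset.mem_image.1 hm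
    rw [Finset.mem_Icc] at *
    rw [abs_le] at hq
    push_cast
    constructor <;> omega
  · gcongr
    push_cast
    linarith

/-- Reduction of the counting estimate for equal signs to coordinate lines. -/
lemma card_resonant_add_le_sum {α : ℝ} (h1 : 1 < α) (h2 : α ≤ 2) {q : Fin 3 → ℤ} {R : ℕ}
    {τ B : ℝ} (hB : 1 ≤ B) (hR : (R : ℝ) ≤ B) (hq : ∀ j, |(q j : ℝ)| + R ≤ B)
    (K : Fin 3 → (Fin 3 → ℤ) → ℝ)
    (hK : ∀ i, ∀ y ∈ slab i R, ∀ F ⊆ box R, (∀ z ∈ F, ∀ j, j ≠ i → z j = y j) →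
      (∀ z ∈ F, |jb (z + q) ^ α + jb z ^ α - τ| ≤ 2) →
      (∀ z ∈ F, ∀ j, (α - 1) / 3 * (2 * B) ^ (α - 2) * |2 * (z j : ℝ) + q j| ≤
        |gradJb α (fun j => ((z + q) j : ℝ)) i + gradJb α (fun j => (z j : ℝ)) i|) →
      (F.card : ℝ) ≤ K i y) :
    (((box R).filter fun z => |jbb α (z + q) + jbb α z - τ| ≤ 1).card : ℝ)
      ≤ ∑ i, ∑ y ∈ slab i R, K i y := by
  classical
  set S := (box R).filter fun z => |jbb α (z + q) + jbb α z - τ| ≤ 1 with hS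
  set T : Fin 3 → Finset (Fin 3 → ℤ) := fun i => S.filter fun z =>
    ∀ j, (α - 1) / 3 * (2 * B) ^ (α - 2) * |2 * (z j : ℝ) + q j| ≤
        |gradJb α (fun j => ((z + q) j : ℝ)) i + gradJb α (fun j => (z j : ℝ)) i| with hT
  have hST : S ⊆ Finset.univ.biUnion T := by
    intro z hz
    have hzR : ∀ j, |(z j : ℝ)| ≤ R := fun j => by
      exact_mod_cast mem_box.1 (Finset.mem_filter.1 hz).1 j
    obtain ⟨i, hi⟩ := exists_gradJb_add_ge h1 h2 (a := fun j => ((z + q) j : ℝ))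
      (b := fun j => (z j : ℝ)) hB
      (fun j => by
        push_cast [Pi.add_apply]
        exact (abs_add_le _ _).trans (by linarith [hzR j, hq j])) (fun j => (hzR j).trans hR)
    refine Finset.mem_biUnion.2 ⟨i, Finset.mem_univ _, Finset.mem_filter.2 ⟨hz, fun j => ?_⟩⟩
    have := hi j
    rwa [show (((z + q) j : ℤ) : ℝ) + (z j : ℝ) = 2 * (z j : ℝ) + q j by
      push_cast [Pi.add_apply]; ring] at this
  have hcard : (S.card : ℝ) ≤ ∑ i, ((T i).card : ℝ) := by
    exact_mod_cast (Finset.card_le_card hST).trans Finset.card_biUnion_le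
  refine hcard.trans (Finset.sum_le_sum fun i _ => ?_)
  refine card_le_sum_of_fiber_le (φ := fun z => Function.update z i 0) ?_ ?_
  · intro z hz
    have hzR := mem_box.1 (Finset.mem_filter.1 (Finset.mem_filter.1 hz).1).1
    refine mem_slab.2 ⟨by simp, fun j hj => ?_⟩
    simpa [hj] using hzR j
  · intro y hy
    refine hK i y hy _ ?_ ?_ ?_ ?_
    · intro z hz
      exact (Finset.mem_filter.1 (Finset.mem_filter.1 (Finset.mem_filter.1 hz).1).1).1
    · intro z hz j hj
      rw [← (Finset.mem_filter.1 hz).2]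
      simp [hj]
    · intro z hz
      exact abs_jb_rpow_add_le (by linarith)
        (Finset.mem_filter.1 (Finset.mem_filter.1 (Finset.mem_filter.1 hz).1).1).2
    · intro z hz
      exact (Finset.mem_filter.1 (Finset.mem_filter.1 hz).1).2

lemma card_line_le {R : ℕ} {i : Fin 3} {y : Fin 3 → ℤ} {F : Finset (Fin 3 → ℤ)}
    (hF : F ⊆ box R) (hy : ∀ z ∈ F, ∀ j, j ≠ i → z j = y j) :
    (F.card : ℝ) ≤ 2 * R + 1 := by
  have hinj : Set.InjOn (fun z : Fin 3 → ℤ => z i) F := by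
    intro z hz z' hz' h
    ext j
    by_cases hj : j = i
    · subst hj; exact h
    · rw [hy z hz j hj, hy z' hz' j hj]
  have := Finset.card_le_card_of_injOn (t := Finset.Icc (-(R : ℤ)) R)
    (fun z : Fin 3 → ℤ => z i)
    (fun z hz => by
      have := mem_box.1 (hF hz) i
      simpa [abs_le] using this) hinj
  rw [Int.card_Icc] at this
  have h2 : F.card ≤ 2 * R + 1 := by omega
  exact_mod_cast h2

/-- The weight used to sum over the coordinate plane orthogonal to `e_i`. -/
def planeWeight (i : Fin 3) (q y : Fin 3 → ℤ) : ℝ :=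
  ∏ j, if j = i then 1 else 1 / Real.sqrt (1 + |2 * (y j : ℝ) + q j|)

lemma sum_planeWeight_le (i : Fin 3) {R : ℕ} (hR : 1 ≤ R) {q : Fin 3 → ℤ}
    (hq : ∀ j, |q j| ≤ 4 * R) : ∑ y ∈ slab i R, planeWeight i q y ≤ 112 * R := by
  unfold planeWeight slab
  rw [← Finset.prod_univ_sum (fun j => if j = i then {0} else Finset.Icc (-(R : ℤ)) R)
    (fun j k => if j = i then 1 else 1 / Real.sqrt (1 + |2 * (k : ℝ) + q j|))]
  have hb : ∏ j, ∑ k ∈ (if j = i then {0} else Finset.Icc (-(R : ℤ)) R),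
      (if j = i then 1 else 1 / Real.sqrt (1 + |2 * (k : ℝ) + q j|)) ≤
      ∏ j, (if j = i then 1 else 4 * Real.sqrt (7 * R)) := by
    refine Finset.prod_le_prod (fun j _ => Finset.sum_nonneg fun k _ => ?_) fun j _ => ?_
    · split_ifs <;> positivity
    · by_cases hj : j = i
      · simp [hj]
      · simp only [hj, if_false]
        exact sum_inv_sqrt_affine_le hR (hq j)
  refine hb.trans (le_of_eq ?_)
  have hs : Real.sqrt (7 * (R : ℝ)) ^ 2 = 7 * R := Real.sq_sqrt (by positivity)
  rw [Finset.prod_ite, Finset.prod_const, Finset.prod_const]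
  have hc : (Finset.univ.filter fun j : Fin 3 => ¬ j = i).card = 2 := by
    fin_cases i <;> decide
  rw [hc, one_pow, mul_pow, hs]
  ring

lemma inv_le_planeWeight {i : Fin 3} {q y : Fin 3 → ℤ} {v : ℝ}
    (hv : ∀ j, j ≠ i → |2 * (y j : ℝ) + q j| ≤ v) (hv0 : 0 ≤ v) :
    1 / (1 + v) ≤ planeWeight i q y := by
  unfold planeWeight
  have : ∏ j, (if j = i then 1 else 1 / Real.sqrt (1 + v)) ≤
      ∏ j, (if j = i then 1 else 1 / Real.sqrt (1 + |2 * (y j : ℝ) + q j|)) := by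
    refine Finset.prod_le_prod (fun j _ => ?_) fun j _ => ?_
    · split_ifs <;> positivity
    · by_cases hj : j = i
      · simp [hj]
      · simp only [hj, if_false]
        have := hv j hj
        gcongr
  refine le_trans (le_of_eq ?_) this
  have hs : Real.sqrt (1 + v) ^ 2 = 1 + v := Real.sq_sqrt (by positivity)
  rw [Finset.prod_ite, Finset.prod_const, Finset.prod_const]
  have hc : (Finset.univ.filter fun j : Fin 3 => ¬ j = i).card = 2 := by
    fin_cases i <;> decide
  rw [hc, div_pow, hs]
  simp

/-- Counting estimate for equal signs. -/
lemma card_resonant_add_le {α : ℝ} (h1 : 1 < α) (h2 : α ≤ 2) :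
    ∃ C : ℝ, 0 < C ∧ ∀ (q : Fin 3 → ℤ) (R : ℕ) (τ : ℝ), 1 ≤ R →
      (((box R).filter fun z => |jbb α (z + q) + jbb α z - τ| ≤ 1).card : ℝ)
        ≤ C * (R : ℝ) ^ 2 := by
  have hα : 0 < (α - 1) / 3 := by linarith
  set c := (α - 1) / 3 with hc
  refine ⟨336 * (160 / c + 24), by positivity, fun q R τ hR => ?_⟩
  have hRR : (1 : ℝ) ≤ R := by exact_mod_cast hR
  by_cases hq : ∀ j, |q j| ≤ 4 * R
  · have hqR : ∀ j, |(q j : ℝ)| ≤ 4 * R := fun j => by exact_mod_cast hq j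
    refine (card_resonant_add_le_sum h1 h2 (B := 5 * R) (by linarith) (by linarith)
      (fun j => by linarith [hqR j]) (fun i y => (160 / c + 24) * R * planeWeight i q y)
      ?_).trans ?_
    · intro i y hy F hF hyF hτ hg
      obtain ⟨k, hk, hkm⟩ := Finset.exists_max_image (Finset.univ.erase i)
        (fun j => |2 * (y j : ℝ) + q j|)
        (Finset.card_pos.1 (by rw [Finset.card_erase_of_mem (Finset.mem_univ _)]; simp))
      have hki : k ≠ i := Finset.ne_of_mem_erase hk
      set v := |2 * (y k : ℝ) + q k| with hv
      have hw := inv_le_planeWeight (i := i) (q := q) (y := y) (v := v)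
        (fun j hj => hkm j (Finset.mem_erase.2 ⟨hj, Finset.mem_univ _⟩)) (abs_nonneg _)
      rcases Nat.eq_zero_or_pos (2 * y k + q k).natAbs with h0 | h0
      · have hv0 : v = 0 := by
          rw [hv, abs_eq_zero]; exact_mod_cast Int.natAbs_eq_zero.1 h0
        rw [hv0] at hw
        have hcl := card_line_le hF hyF
        have : 0 ≤ 160 / c := by positivity
        nlinarith [mul_nonneg this (by linarith : (0 : ℝ) ≤ R)]
      · have hv1 : 1 ≤ v := by
          have : (1 : ℤ) ≤ |2 * y k + q k| := by
            rw [Int.abs_eq_natAbs]; omega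
          rw [hv]; exact_mod_cast this
        have hv6 : v ≤ 6 * R := by
          have := (mem_slab.1 hy).2 k hki
          have h' : |(y k : ℝ)| ≤ R := by exact_mod_cast this
          refine (abs_add_le _ _).trans ?_
          rw [abs_mul, abs_of_pos (by norm_num : (0 : ℝ) < 2)]
          linarith [hqR k]
        have hp : 1 / (10 * R : ℝ) ≤ (2 * (5 * R : ℝ)) ^ (α - 2) := by
          rw [one_div, ← Real.rpow_neg_one, show 2 * (5 * R : ℝ) = 10 * R by ring]
          exact Real.rpow_le_rpow_of_exponent_le (by linarith) (by linarith)
        have hlam : 0 < c * (1 / (10 * R : ℝ)) * v := by positivity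
        have hcl := card_line_add_le h1 h2 hlam F
          (fun z hz z' hz' j hj => (hyF z hz j hj).trans (hyF z' hz' j hj).symm) hτ
          (fun z hz => by
            refine le_trans ?_ (hg z hz k)
            rw [hyF z hz k hki]
            gcongr)
        refine hcl.trans ?_
        have e : 2 * (4 / (c * (1 / (10 * R : ℝ)) * v) + 1) = 80 / c * R * (1 / v) + 2 := by
          field_simp; ring
        have b1 : 2 ≤ 12 * R * (1 / v) := by
          rw [mul_one_div, le_div_iff₀ (by linarith)]; linarith
        have b2 : 1 / v ≤ 2 * (1 / (1 + v)) := by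
          rw [mul_one_div, div_le_div_iff₀ (by linarith) (by linarith)]; linarith
        calc 2 * (4 / (c * (1 / (10 * R : ℝ)) * v) + 1)
            ≤ (80 / c + 12) * R * (1 / v) := by rw [e]; linarith
          _ ≤ (80 / c + 12) * R * (2 * planeWeight i q y) := by
              have : 1 / v ≤ 2 * planeWeight i q y := by linarith
              gcongr
          _ = (160 / c + 24) * R * planeWeight i q y := by ring
    · have : ∀ i ∈ (Finset.univ : Finset (Fin 3)),
          ∑ y ∈ slab i R, (160 / c + 24) * R * planeWeight i q y ≤
            (160 / c + 24) * R * (112 * R) := by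
        intro i _
        rw [← Finset.mul_sum]
        have := sum_planeWeight_le i hR hq
        gcongr
      refine (Finset.sum_le_sum this).trans (le_of_eq ?_)
      simp
      ring
  · push Not at hq
    obtain ⟨i₁, hi₁⟩ := hq
    obtain ⟨i₀, -, hi₀⟩ := Finset.exists_max_image Finset.univ (fun j => |q j|)
      ⟨0, Finset.mem_univ _⟩
    have hQ4 : (4 * R : ℝ) < |(q i₀ : ℝ)| := by
      exact_mod_cast hi₁.trans_le (hi₀ i₁ (Finset.mem_univ _))
    set Q := |(q i₀ : ℝ)| with hQ
    have hqQ : ∀ j, |(q j : ℝ)| ≤ Q := fun j => by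
      rw [hQ]; exact_mod_cast hi₀ j (Finset.mem_univ _)
    refine (card_resonant_add_le_sum h1 h2 (B := 2 * Q) (by linarith) (by linarith)
      (fun j => by linarith [hqQ j]) (fun i y => 2 * (4 / (c / 8) + 1)) ?_).trans ?_
    · intro i y hy F hF hyF hτ hg
      refine card_line_add_le h1 h2 (by positivity) F
          (fun z hz z' hz' j hj => (hyF z hz j hj).trans (hyF z' hz' j hj).symm) hτ
          (fun z hz => ?_)
      refine le_trans ?_ (hg z hz i₀)
      have hp : 1 / (4 * Q) ≤ (2 * (2 * Q)) ^ (α - 2) := by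
        rw [one_div, ← Real.rpow_neg_one, show 2 * (2 * Q) = 4 * Q by ring]
        exact Real.rpow_le_rpow_of_exponent_le (by linarith) (by linarith)
      have hz : |(z i₀ : ℝ)| ≤ R := by exact_mod_cast mem_box.1 (hF hz) i₀
      have hz2 : Q / 2 ≤ |2 * (z i₀ : ℝ) + q i₀| := by
        have := abs_sub_abs_le_abs_sub (q i₀ : ℝ) (-(2 * (z i₀ : ℝ)))
        rw [abs_neg, abs_mul, abs_of_pos (by norm_num : (0 : ℝ) < 2), sub_neg_eq_add,
          add_comm (q i₀ : ℝ)] at this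
        linarith
      have hQ0 : 0 < Q := by linarith
      calc c / 8 = c * (1 / (4 * Q)) * (Q / 2) := by field_simp; norm_num
        _ ≤ _ := by gcongr
    · have : ∀ i ∈ (Finset.univ : Finset (Fin 3)),
          ∑ y ∈ slab i R, 2 * (4 / (c / 8) + 1) ≤ 9 * (R : ℝ) ^ 2 * (2 * (4 / (c / 8) + 1)) := by
        intro i _
        rw [Finset.sum_const, nsmul_eq_mul]
        have := card_slab_le i hR
        gcongr
      refine (Finset.sum_le_sum this).trans ?_
      simp only [Finset.sum_const, Finset.card_univ, Fintype.card_fin, nsmul_eq_mul]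
      have e : 4 / (c / 8) = 32 / c := by field_simp; norm_num
      rw [e]
      have : 0 ≤ 1 / c := by positivity
      rw [show 32 / c = 32 * (1 / c) by ring, show 160 / c = 160 * (1 / c) by ring]
      have hR2 : 0 ≤ (R : ℝ) ^ 2 := by positivity
      push_cast
      nlinarith [mul_nonneg this hR2]

/-- Counting estimate for arbitrary signs. -/
lemma card_resonant_le {α : ℝ} (h1 : 1 < α) (h2 : α ≤ 2) :
    ∃ C : ℝ, 0 < C ∧ ∀ (s s' : Bool) (q : Fin 3 → ℤ) (R : ℕ) (τ : ℝ), 1 ≤ R →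
      (((box R).filter fun z => |sgn s * jbb α (z + q) + sgn s' * jbb α z - τ| ≤ 1).card : ℝ)
        ≤ C * ((R : ℝ) ^ 2 + (R : ℝ) ^ 3 / jb q) := by
  obtain ⟨C₁, hC₁, H₁⟩ := card_resonant_add_le h1 h2
  obtain ⟨C₂, hC₂, H₂⟩ := card_resonant_sub_le h1 h2
  refine ⟨C₁ + C₂, by positivity, fun s s' q R τ hR => ?_⟩
  have hX : 0 ≤ (R : ℝ) ^ 2 := by positivity
  have hY : 0 ≤ (R : ℝ) ^ 3 / jb q := div_nonneg (by positivity) (jb_pos q).le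
  have k1 : ∀ σ, (((box R).filter fun z => |jbb α (z + q) + jbb α z - σ| ≤ 1).card : ℝ) ≤
      (C₁ + C₂) * ((R : ℝ) ^ 2 + (R : ℝ) ^ 3 / jb q) := fun σ => by
    have := H₁ q R σ hR
    nlinarith [mul_nonneg hC₁.le hY, mul_nonneg hC₂.le hY, mul_nonneg hC₂.le hX]
  have k2 : ∀ σ, (((box R).filter fun z => |jbb α (z + q) - jbb α z - σ| ≤ 1).card : ℝ) ≤
      (C₁ + C₂) * ((R : ℝ) ^ 2 + (R : ℝ) ^ 3 / jb q) := fun σ => by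
    have := H₂ q R σ hR
    nlinarith [mul_nonneg hC₁.le hY, mul_nonneg hC₁.le hX]
  rcases s with _ | _ <;> rcases s' with _ | _ <;> simp only [sgn, if_true, if_false,
    Bool.false_eq_true]
  · convert k1 (-τ) using 4 with z
    rw [← abs_neg]; congr! 2; ring
  · convert k2 (-τ) using 4 with z
    rw [← abs_neg]; congr! 2; ring
  · convert k2 τ using 4 with z
    congr! 2; ring
  · convert k1 τ using 4 with z
    congr! 2; ring

lemma exists_two_pow_near {x : ℝ} {K : ℕ} (h1 : 1 ≤ x) (hK : x ≤ 2 ^ K) :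
    ∃ k ∈ Finset.range (K + 1), x ≤ 2 ^ k ∧ (2 : ℝ) ^ k ≤ 2 * x := by
  classical
  have hex : ∃ k : ℕ, x ≤ 2 ^ k := ⟨K, hK⟩
  refine ⟨Nat.find hex, Finset.mem_range.2 (Nat.lt_succ_of_le (Nat.find_min' hex hK)),
    Nat.find_spec hex, ?_⟩
  rcases Nat.eq_zero_or_pos (Nat.find hex) with h0 | h0
  · rw [h0]; linarith
  · have := Nat.find_min hex (Nat.sub_one_lt_of_lt h0)
    rw [not_le] at this
    have e : (2 : ℝ) ^ Nat.find hex = 2 ^ (Nat.find hex - 1) * 2 := by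
      rw [← pow_succ]; congr 1; omega
    rw [e]; linarith

/-- Dyadic decomposition of a weighted sum. -/
lemma sum_le_sum_dyadic {β : Type*} (s : Finset β) {x f : β → ℝ} {g : ℕ → ℝ} {K : ℕ}
    (hx : ∀ b ∈ s, 1 ≤ x b) (hK : ∀ b ∈ s, x b ≤ 2 ^ K) (hg : ∀ k, 0 ≤ g k)
    (hf : ∀ b ∈ s, ∀ k, x b ≤ 2 ^ k → (2 : ℝ) ^ k ≤ 2 * x b → f b ≤ g k) :
    ∑ b ∈ s, f b ≤ ∑ k ∈ Finset.range (K + 1), g k * ((s.filter fun b => x b ≤ 2 ^ k).card) := by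
  classical
  have h : ∀ b ∈ s, f b ≤ ∑ k ∈ Finset.range (K + 1), if x b ≤ 2 ^ k then g k else 0 := by
    intro b hb
    obtain ⟨k, hk, h1, h2⟩ := exists_two_pow_near (hx b hb) (hK b hb)
    refine (hf b hb k h1 h2).trans ?_
    have := Finset.single_le_sum (f := fun k => if x b ≤ 2 ^ k then g k else 0)
      (fun k _ => by split_ifs; exacts [hg k, le_rfl]) hk
    simpa [h1] using this
  refine (Finset.sum_le_sum h).trans (le_of_eq ?_)
  rw [Finset.sum_comm]
  refine Finset.sum_congr rfl fun k _ => ?_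
  rw [← Finset.sum_filter, Finset.sum_const, nsmul_eq_mul, mul_comm]

lemma jb_le_of_mem_box {K : ℕ} {z : Fin 3 → ℤ} (hz : z ∈ box (2 ^ K)) : jb z ≤ 2 ^ (K + 1) := by
  have h1 : (1 : ℝ) ≤ 2 ^ K := one_le_pow₀ (by norm_num)
  have : rb (fun i => (z i : ℝ)) ≤ 2 * 2 ^ K := rb_le_of_abs_le h1 fun j => by
    exact_mod_cast mem_box.1 hz j
  rw [jb_eq_rb, pow_succ]; linarith

lemma mem_box_of_jb_le {k : ℕ} {z : Fin 3 → ℤ} (hz : jb z ≤ 2 ^ k) : z ∈ box (2 ^ k) :=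
  mem_box.2 fun i => by
    have := (abs_le_jb z i).trans hz
    exact_mod_cast this

lemma sum_jb_inv_cube_le (K : ℕ) :
    ∑ z ∈ box (2 ^ K), (jb z)⁻¹ ^ 3 ≤ 216 * ((K : ℝ) + 2) := by
  classical
  refine (sum_le_sum_dyadic (box (2 ^ K)) (x := jb) (g := fun k => 8 * ((2 : ℝ) ^ k)⁻¹ ^ 3)
    (K := K + 1) (fun b _ => one_le_jb b) (fun b hb => jb_le_of_mem_box hb)
    (fun k => by positivity) ?_).trans ?_
  · intro b _ k _ h2
    have hp := jb_pos b
    have : (jb b)⁻¹ ≤ 2 * ((2 : ℝ) ^ k)⁻¹ := by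
      rw [← div_eq_mul_inv, le_div_iff₀ (by positivity), inv_mul_le_iff₀ hp]; linarith
    calc (jb b)⁻¹ ^ 3 ≤ (2 * ((2 : ℝ) ^ k)⁻¹) ^ 3 := by gcongr
      _ = _ := by ring
  · calc _ ≤ ∑ k ∈ Finset.range (K + 1 + 1), (216 : ℝ) := by
          refine Finset.sum_le_sum fun k _ => ?_
          have hc : (((box (2 ^ K)).filter fun b => jb b ≤ 2 ^ k).card : ℝ) ≤
              27 * ((2 : ℝ) ^ k) ^ 3 := by
            have h1 : (((box (2 ^ K)).filter fun b => jb b ≤ 2 ^ k).card : ℝ) ≤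
                ((box (2 ^ k)).card : ℝ) := by
              exact_mod_cast Finset.card_le_card fun z hz =>
                mem_box_of_jb_le (Finset.mem_filter.1 hz).2
            have h2 := card_box_le (R := 2 ^ k) Nat.one_le_two_pow
            push_cast at h2
            exact h1.trans h2
          calc _ ≤ 8 * ((2 : ℝ) ^ k)⁻¹ ^ 3 * (27 * ((2 : ℝ) ^ k) ^ 3) := by gcongr
            _ = 216 := by field_simp; norm_num
      _ = 216 * ((K : ℝ) + 2) := by
          rw [Finset.sum_const, Finset.card_range, nsmul_eq_mul]; push_cast; ring

lemma sum_box_shift_le {R R' : ℕ} {q : Fin 3 → ℤ} (h : ∀ z ∈ box R, z + q ∈ box R')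
    {f : (Fin 3 → ℤ) → ℝ} (hf : ∀ z, 0 ≤ f z) :
    ∑ z ∈ box R, f (z + q) ≤ ∑ z ∈ box R', f z := by
  classical
  rw [← Finset.sum_image (g := fun z => z + q) (fun a _ b _ hab => add_right_cancel hab)]
  refine Finset.sum_le_sum_of_subset_of_nonneg ?_ fun z _ _ => hf z
  intro z hz
  obtain ⟨w, hw, rfl⟩ := Finset.mem_image.1 hz
  exact h w hw

lemma add_mem_box {R R' : ℕ} {a b : Fin 3 → ℤ} (ha : a ∈ box R) (hb : b ∈ box R') :
    a + b ∈ box (R + R') :=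
  mem_box.2 fun i => (abs_add_le _ _).trans (by
    have := mem_box.1 ha i
    have := mem_box.1 hb i
    push_cast
    omega)

lemma box_mono {R R' : ℕ} (h : R ≤ R') : box R ⊆ box R' := fun z hz =>
  mem_box.2 fun i => (mem_box.1 hz i).trans (by exact_mod_cast h)

lemma ind_nonneg (p : Prop) : 0 ≤ ind p := by unfold ind; split_ifs <;> norm_num

lemma ind_le_one (p : Prop) : ind p ≤ 1 := by unfold ind; split_ifs <;> norm_num

/-- The weight in which resonant lattice points are counted. -/
def poleWeight (q z : Fin 3 → ℤ) : ℝ := (jb z ^ 2 * (jb q + jb z))⁻¹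

lemma poleWeight_nonneg (q z : Fin 3 → ℤ) : 0 ≤ poleWeight q z := by
  have := jb_pos q
  have := jb_pos z
  unfold poleWeight
  positivity

lemma sum_poleWeight_resonant_le {α : ℝ} (h1 : 1 < α) (h2 : α ≤ 2) :
    ∃ C : ℝ, 0 < C ∧ ∀ (s s' : Bool) (q : Fin 3 → ℤ) (K : ℕ) (τ : ℝ),
      ∑ z ∈ box (2 ^ K), poleWeight q z *
          ind (|sgn s * jbb α (z + q) + sgn s' * jbb α z - τ| ≤ 1)
        ≤ C * ((K : ℝ) + 2) * (jb q)⁻¹ := by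
  classical
  obtain ⟨C, hC, H⟩ := card_resonant_le h1 h2
  refine ⟨8 * C, by positivity, fun s s' q K τ => ?_⟩
  have hq := jb_pos q
  set p : (Fin 3 → ℤ) → Prop := fun z => |sgn s * jbb α (z + q) + sgn s' * jbb α z - τ| ≤ 1
  have e : ∑ z ∈ box (2 ^ K), poleWeight q z * ind (p z) =
      ∑ z ∈ (box (2 ^ K)).filter p, poleWeight q z := by
    rw [Finset.sum_filter]
    refine Finset.sum_congr rfl fun z _ => ?_
    unfold ind
    split_ifs <;> simp
  rw [e]
  refine (sum_le_sum_dyadic ((box (2 ^ K)).filter p) (x := jb)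
    (g := fun k => 8 * (((2 : ℝ) ^ k) ^ 2 * (jb q + 2 ^ k))⁻¹)
    (K := K + 1) (fun b _ => one_le_jb b)
    (fun b hb => jb_le_of_mem_box (Finset.mem_filter.1 hb).1)
    (fun k => by positivity) ?_).trans ?_
  · intro b _ k _ hk
    have hp := jb_pos b
    unfold poleWeight
    rw [← div_eq_mul_inv, le_div_iff₀ (by positivity), inv_mul_le_iff₀ (by positivity)]
    calc ((2 : ℝ) ^ k) ^ 2 * (jb q + 2 ^ k) ≤ (2 * jb b) ^ 2 * (2 * jb q + 2 * jb b) := by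
          gcongr; linarith
      _ = _ := by ring
  · calc _ ≤ ∑ k ∈ Finset.range (K + 1 + 1), 8 * C * (jb q)⁻¹ := by
          refine Finset.sum_le_sum fun k _ => ?_
          have hc : ((((box (2 ^ K)).filter p).filter fun b => jb b ≤ 2 ^ k).card : ℝ) ≤
              C * (((2 : ℝ) ^ k) ^ 2 + ((2 : ℝ) ^ k) ^ 3 / jb q) := by
            have h1 : ((((box (2 ^ K)).filter p).filter fun b => jb b ≤ 2 ^ k).card : ℝ) ≤
                (((box (2 ^ k)).filter p).card : ℝ) := by
              exact_mod_cast Finset.card_le_card fun z hz => Finset.mem_filter.2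
                ⟨mem_box_of_jb_le (Finset.mem_filter.1 hz).2,
                  (Finset.mem_filter.1 (Finset.mem_filter.1 hz).1).2⟩
            have h2 := H s s' q (2 ^ k) τ Nat.one_le_two_pow
            push_cast at h2
            exact h1.trans (by convert h2)
          calc _ ≤ 8 * (((2 : ℝ) ^ k) ^ 2 * (jb q + 2 ^ k))⁻¹ *
                (C * (((2 : ℝ) ^ k) ^ 2 + ((2 : ℝ) ^ k) ^ 3 / jb q)) := by gcongr
            _ = 8 * C * (jb q)⁻¹ := by field_simp
      _ = 8 * C * ((K : ℝ) + 2) * (jb q)⁻¹ := by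
          rw [Finset.sum_const, Finset.card_range, nsmul_eq_mul]; push_cast; ring

lemma sum_poleWeight_shift_resonant_le {α : ℝ} (h1 : 1 < α) (h2 : α ≤ 2) :
    ∃ C : ℝ, 0 < C ∧ ∀ (s s' : Bool) (K : ℕ) (q : Fin 3 → ℤ) (τ : ℝ), q ∈ box (2 * 2 ^ K) →
      ∑ z ∈ box (2 ^ K), (poleWeight q z + poleWeight q (z + q)) *
          ind (|sgn s * jbb α (z + q) + sgn s' * jbb α z - τ| ≤ 1)
        ≤ C * ((K : ℝ) + 1) * (jb q)⁻¹ := by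
  obtain ⟨C, hC, H⟩ := sum_poleWeight_resonant_le h1 h2
  refine ⟨6 * C, by positivity, fun s s' K q τ hqK => ?_⟩
  have hq := jb_pos q
  have t1 := H s s' q K τ
  have t2 := H s' s (-q) (K + 2) τ
  have t3 : ∑ z ∈ box (2 ^ K), poleWeight q (z + q) *
      ind (|sgn s * jbb α (z + q) + sgn s' * jbb α z - τ| ≤ 1) ≤
      ∑ z ∈ box (2 ^ (K + 2)), poleWeight (-q) z *
          ind (|sgn s' * jbb α (z + -q) + sgn s * jbb α z - τ| ≤ 1) := by
    refine le_trans (le_of_eq ?_) (sum_box_shift_le (R := 2 ^ K) (q := q) (fun z hz => ?_)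
      (fun z => mul_nonneg (poleWeight_nonneg _ _) (ind_nonneg _)))
    · refine Finset.sum_congr rfl fun z _ => ?_
      rw [add_neg_cancel_right, add_comm (sgn s' * _)]
      simp only [poleWeight, jb_neg]
    · refine box_mono ?_ (add_mem_box hz hqK)
      rw [pow_add]; omega
  rw [jb_neg] at t2
  simp only [add_mul, Finset.sum_add_distrib]
  have hi : 0 < C * (jb q)⁻¹ := by positivity
  push_cast at t2
  have hK : (0 : ℝ) ≤ K := Nat.cast_nonneg K
  nlinarith [mul_nonneg hi.le hK]

/-- The resonance function. -/
def kap (α : ℝ) (e : Fin 4 → Bool) (a b c : Fin 3 → ℤ) : ℝ :=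
  sgn (e 0) * jbb α (a + b + c) + sgn (e 1) * jbb α a + sgn (e 2) * jbb α b + sgn (e 3) * jbb α c

/-- Values of the modulation that occur for frequencies in `[-2^K, 2^K]³`. -/
def modRange (K : ℕ) : Finset ℤ := Finset.Icc (-(2 : ℤ) ^ (2 * K + 6)) (2 ^ (2 * K + 6))

/-- The sum over signs and modulations, without the frequency weights. -/
def resWt (α : ℝ) (K : ℕ) (a b c : Fin 3 → ℤ) : ℝ :=
  ∑ e : Fin 4 → Bool, ∑ m ∈ modRange K, (rjb (m : ℝ))⁻¹ * ind (|kap α e a b c - m| ≤ 1)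

/-- The kernel `Λ` at the critical exponent of the frequency weights. -/
def lamJ (α : ℝ) (K : ℕ) (a b c : Fin 3 → ℤ) : ℝ :=
  (jb (a + b + c))⁻¹ * ((jb a)⁻¹ * (jb b)⁻¹ * (jb c)⁻¹) * resWt α K a b c

lemma one_le_rjb (x : ℝ) : 1 ≤ rjb x := by
  rw [rjb, Real.one_le_sqrt]; linarith [sq_nonneg x]

lemma rjb_pos (x : ℝ) : 0 < rjb x := zero_lt_one.trans_le (one_le_rjb x)

lemma resWt_nonneg (α : ℝ) (K : ℕ) (a b c : Fin 3 → ℤ) : 0 ≤ resWt α K a b c :=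
  Finset.sum_nonneg fun _ _ => Finset.sum_nonneg fun m _ =>
    mul_nonneg (inv_nonneg.2 (rjb_pos m).le) (ind_nonneg _)

lemma lamJ_nonneg (α : ℝ) (K : ℕ) (a b c : Fin 3 → ℤ) : 0 ≤ lamJ α K a b c := by
  have := jb_pos a
  have := jb_pos b
  have := jb_pos c
  have := jb_pos (a + b + c)
  have := resWt_nonneg α K a b c
  unfold lamJ
  positivity

lemma resWt_le (α : ℝ) (K : ℕ) (a b c : Fin 3 → ℤ) : resWt α K a b c ≤ 48 := by
  classical
  have h : ∀ e : Fin 4 → Bool, ∑ m ∈ modRange K,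
      (rjb (m : ℝ))⁻¹ * ind (|kap α e a b c - m| ≤ 1) ≤ 3 := by
    intro e
    calc _ ≤ ∑ m ∈ modRange K, if |kap α e a b c - m| ≤ 1 then (1 : ℝ) else 0 := by
          refine Finset.sum_le_sum fun m _ => ?_
          have := inv_le_one_of_one_le₀ (one_le_rjb m)
          unfold ind
          split_ifs <;> simp [this]
      _ = (((modRange K).filter fun m : ℤ => |kap α e a b c - m| ≤ 1).card : ℝ) := by
          rw [Finset.sum_ite]; simp
      _ ≤ 2 + 1 := by
          refine card_le_of_sub_le _ (by norm_num) fun s hs t ht _ => ?_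
          have h1 := abs_le.1 (Finset.mem_filter.1 hs).2
          have h2 := abs_le.1 (Finset.mem_filter.1 ht).2
          linarith [h1.2, h2.1]
      _ = 3 := by norm_num
  refine (Finset.sum_le_sum fun e _ => h e).trans (le_of_eq ?_)
  simp
  norm_num

lemma sum_rjb_inv_le (K : ℕ) :
    ∑ m ∈ modRange K, (rjb (m : ℝ))⁻¹ ≤ 48 * ((K : ℝ) + 1) := by
  classical
  refine (sum_le_sum_dyadic (modRange K) (x := fun m : ℤ => rjb m)
    (g := fun k => 2 * ((2 : ℝ) ^ k)⁻¹) (K := 2 * K + 7) (fun m _ => one_le_rjb m) ?_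
    (fun k => by positivity) ?_).trans ?_
  · intro m hm
    have hm' : |m| ≤ 2 ^ (2 * K + 6) := abs_le.2 (Finset.mem_Icc.1 hm)
    have hm2 : |(m : ℝ)| ≤ 2 ^ (2 * K + 6) := by exact_mod_cast hm'
    refine Real.sqrt_le_iff.2 ⟨by positivity, ?_⟩
    have h1 : (1 : ℝ) ≤ 2 ^ (2 * K + 6) := one_le_pow₀ (by norm_num)
    rw [pow_succ (2 : ℝ) (2 * K + 6), ← sq_abs (m : ℝ)]
    nlinarith [abs_nonneg (m : ℝ)]
  · intro m _ k _ h2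
    have hp := rjb_pos m
    rw [← div_eq_mul_inv, le_div_iff₀ (by positivity), inv_mul_le_iff₀ hp]; linarith
  · calc _ ≤ ∑ k ∈ Finset.range (2 * K + 7 + 1), (6 : ℝ) := by
          refine Finset.sum_le_sum fun k _ => ?_
          have h1 : (1 : ℝ) ≤ 2 ^ k := one_le_pow₀ (by norm_num)
          have hc : (((modRange K).filter fun m : ℤ => rjb m ≤ 2 ^ k).card : ℝ) ≤
              3 * (2 : ℝ) ^ k := by
            refine (card_le_of_sub_le _ (B := 2 * 2 ^ k) (by positivity)
              fun s hs t ht _ => ?_).trans (by linarith)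
            have hb : ∀ m : ℤ, |(m : ℝ)| ≤ rjb m := fun m =>
              Real.abs_le_sqrt (by linarith)
            have h1 := abs_le.1 ((hb s).trans (Finset.mem_filter.1 hs).2)
            have h2 := abs_le.1 ((hb t).trans (Finset.mem_filter.1 ht).2)
            linarith [h1.1, h2.2]
          calc _ ≤ 2 * ((2 : ℝ) ^ k)⁻¹ * (3 * (2 : ℝ) ^ k) := by gcongr
            _ = 6 := by field_simp; norm_num
      _ = 6 * (2 * (K : ℝ) + 8) := by
          rw [Finset.sum_const, Finset.card_range, nsmul_eq_mul]; push_cast; ring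
      _ ≤ _ := by linarith [(Nat.cast_nonneg K : (0 : ℝ) ≤ K)]

lemma add_mem_box_two_mul {R : ℕ} {a b : Fin 3 → ℤ} (ha : a ∈ box R) (hb : b ∈ box R) :
    a + b ∈ box (2 * R) := two_mul R ▸ add_mem_box ha hb

lemma sum_poleWeight_resWt_le {α : ℝ} (h1 : 1 < α) (h2 : α ≤ 2) :
    ∃ C : ℝ, 0 < C ∧ ∀ (K : ℕ), ∀ a ∈ box (2 ^ K), ∀ b ∈ box (2 ^ K),
      ∑ z ∈ box (2 ^ K), (poleWeight (a + b) z + poleWeight (a + b) (z + (a + b))) *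
          resWt α K a b z ≤ C * ((K : ℝ) + 1) ^ 2 * (jb (a + b))⁻¹ := by
  obtain ⟨C, hC, H⟩ := sum_poleWeight_shift_resonant_le h1 h2
  refine ⟨768 * C, by positivity, fun K a ha b hb => ?_⟩
  set q := a + b with hq
  have hqp := jb_pos q
  have hKp : (0 : ℝ) ≤ K := Nat.cast_nonneg K
  have hin : ∀ e : Fin 4 → Bool, ∀ m ∈ modRange K,
      ∑ z ∈ box (2 ^ K), (poleWeight q z + poleWeight q (z + q)) *
        ind (|kap α e a b z - m| ≤ 1) ≤ C * ((K : ℝ) + 1) * (jb q)⁻¹ := by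
    intro e m _
    refine le_trans (le_of_eq (Finset.sum_congr rfl fun z _ => ?_))
      (H (e 0) (e 3) K q (m - sgn (e 1) * jbb α a - sgn (e 2) * jbb α b)
        (add_mem_box_two_mul ha hb))
    congr 3
    rw [kap, ← hq, add_comm q z]
    congr 1
    ring
  calc ∑ z ∈ box (2 ^ K), (poleWeight q z + poleWeight q (z + q)) * resWt α K a b z
      = ∑ e : Fin 4 → Bool, ∑ m ∈ modRange K, (rjb (m : ℝ))⁻¹ *
          ∑ z ∈ box (2 ^ K), (poleWeight q z + poleWeight q (z + q)) *
            ind (|kap α e a b z - m| ≤ 1) := by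
        simp only [resWt, Finset.mul_sum]
        rw [Finset.sum_comm]
        refine Finset.sum_congr rfl fun e _ => ?_
        rw [Finset.sum_comm]
        exact Finset.sum_congr rfl fun m _ => Finset.sum_congr rfl fun z _ => by ring
    _ ≤ ∑ e : Fin 4 → Bool, ∑ m ∈ modRange K, (rjb (m : ℝ))⁻¹ *
          (C * ((K : ℝ) + 1) * (jb q)⁻¹) := by
        refine Finset.sum_le_sum fun e _ => Finset.sum_le_sum fun m hm => ?_
        exact mul_le_mul_of_nonneg_left (hin e m hm) (inv_nonneg.2 (rjb_pos m).le)
    _ = 16 * ((∑ m ∈ modRange K, (rjb (m : ℝ))⁻¹) * (C * ((K : ℝ) + 1) * (jb q)⁻¹)) := by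
        rw [Finset.sum_const, Finset.sum_mul]
        simp
    _ ≤ 16 * ((48 * ((K : ℝ) + 1)) * (C * ((K : ℝ) + 1) * (jb q)⁻¹)) := by
        have := sum_rjb_inv_le K
        gcongr
    _ = _ := by ring

lemma jb_inv_sq_mul_le (q z : Fin 3 → ℤ) :
    (jb z)⁻¹ ^ 2 * (jb (z + q))⁻¹ ≤ 3 * (poleWeight q z + poleWeight q (z + q)) := by
  have hx := jb_pos z
  have hy := jb_pos (z + q)
  have hq := jb_pos q
  have n1 := poleWeight_nonneg q z
  have n2 := poleWeight_nonneg q (z + q)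
  have htri : jb q ≤ jb z + jb (z + q) := by
    have := jb_add_le (-z) (z + q)
    rwa [neg_add_cancel_left, jb_neg] at this
  set x := jb z
  set y := jb (z + q)
  have e : x⁻¹ ^ 2 * y⁻¹ = (x ^ 2 * y)⁻¹ := by rw [mul_inv, inv_pow]
  rw [e]
  rcases le_total x y with h | h
  · have : (x ^ 2 * y)⁻¹ ≤ 3 * poleWeight q z := by
      unfold poleWeight
      rw [← div_eq_mul_inv, le_div_iff₀ (by positivity), inv_mul_le_iff₀ (by positivity)]
      change x ^ 2 * (jb q + x) ≤ _
      nlinarith [mul_le_mul_of_nonneg_left (by linarith : jb q + x ≤ 3 * y) (sq_nonneg x)]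
    linarith
  · have : (x ^ 2 * y)⁻¹ ≤ 3 * poleWeight q (z + q) := by
      unfold poleWeight
      rw [← div_eq_mul_inv, le_div_iff₀ (by positivity), inv_mul_le_iff₀ (by positivity)]
      change y ^ 2 * (jb q + y) ≤ _
      have a1 := mul_le_mul_of_nonneg_left (by linarith : jb q + y ≤ 3 * x) (sq_nonneg y)
      have a2 := mul_le_mul_of_nonneg_left h (mul_nonneg hx.le hy.le)
      nlinarith
    linarith

lemma jb_mul_inv_sq_le (q z : Fin 3 → ℤ) :
    jb q * ((jb z)⁻¹ ^ 2 * (jb (z + q))⁻¹ ^ 2) ≤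
      6 * (poleWeight q z + poleWeight q (z + q)) := by
  have hx := jb_pos z
  have hy := jb_pos (z + q)
  have hq := jb_pos q
  have htri : jb q ≤ jb z + jb (z + q) := by
    have := jb_add_le (-z) (z + q)
    rwa [neg_add_cancel_left, jb_neg] at this
  have k1 := jb_inv_sq_mul_le q z
  have k2 := jb_inv_sq_mul_le (-q) (z + q)
  rw [add_neg_cancel_right] at k2
  have e : ∀ w, poleWeight (-q) w = poleWeight q w := fun w => by simp only [poleWeight, jb_neg]
  rw [e, e] at k2
  set x := jb z
  set y := jb (z + q)
  calc jb q * (x⁻¹ ^ 2 * y⁻¹ ^ 2) ≤ (x + y) * (x⁻¹ ^ 2 * y⁻¹ ^ 2) := by gcongr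
    _ = y⁻¹ ^ 2 * x⁻¹ + x⁻¹ ^ 2 * y⁻¹ := by field_simp
    _ ≤ _ := by linarith

/-- Summation of the kernel against one inverse weight. -/
lemma sum_lamJ_mul_inv_le {α : ℝ} (h1 : 1 < α) (h2 : α ≤ 2) :
    ∃ C : ℝ, 0 < C ∧ ∀ (K : ℕ), ∀ a ∈ box (2 ^ K), ∀ b ∈ box (2 ^ K),
      ∑ z ∈ box (2 ^ K), lamJ α K a b z * (jb z)⁻¹ ≤
        C * ((K : ℝ) + 1) ^ 2 * ((jb a)⁻¹ * (jb b)⁻¹ * (jb (a + b))⁻¹) := by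
  obtain ⟨C, hC, H⟩ := sum_poleWeight_resWt_le h1 h2
  refine ⟨3 * C, by positivity, fun K a ha b hb => ?_⟩
  have pa := jb_pos a
  have pb := jb_pos b
  calc ∑ z ∈ box (2 ^ K), lamJ α K a b z * (jb z)⁻¹
      ≤ ∑ z ∈ box (2 ^ K), (jb a)⁻¹ * (jb b)⁻¹ * 3 *
          ((poleWeight (a + b) z + poleWeight (a + b) (z + (a + b))) * resWt α K a b z) := by
        refine Finset.sum_le_sum fun z _ => ?_
        have := mul_le_mul_of_nonneg_right (jb_inv_sq_mul_le (a + b) z) (resWt_nonneg α K a b z)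
        have := mul_le_mul_of_nonneg_left this
          (by positivity : 0 ≤ (jb a)⁻¹ * (jb b)⁻¹)
        rw [lamJ, add_comm (a + b) z]
        linarith
    _ ≤ (jb a)⁻¹ * (jb b)⁻¹ * 3 * (C * ((K : ℝ) + 1) ^ 2 * (jb (a + b))⁻¹) := by
        rw [← Finset.mul_sum]
        have := H K a ha b hb
        gcongr
    _ = _ := by ring

lemma sum_lamJ_sq_le {α : ℝ} (h1 : 1 < α) (h2 : α ≤ 2) :
    ∃ C : ℝ, 0 < C ∧ ∀ (K : ℕ), ∀ a ∈ box (2 ^ K), ∀ b ∈ box (2 ^ K),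
      ∑ z ∈ box (2 ^ K), lamJ α K a b z ^ 2 ≤
        C * ((K : ℝ) + 1) ^ 2 * ((jb a)⁻¹ * (jb b)⁻¹ * (jb (a + b))⁻¹) ^ 2 := by
  obtain ⟨C, hC, H⟩ := sum_poleWeight_resWt_le h1 h2
  refine ⟨288 * C, by positivity, fun K a ha b hb => ?_⟩
  have pa := jb_pos a
  have pb := jb_pos b
  have pq := jb_pos (a + b)
  calc ∑ z ∈ box (2 ^ K), lamJ α K a b z ^ 2
      ≤ ∑ z ∈ box (2 ^ K), ((jb a)⁻¹ * (jb b)⁻¹) ^ 2 * (jb (a + b))⁻¹ * 288 *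
          ((poleWeight (a + b) z + poleWeight (a + b) (z + (a + b))) * resWt α K a b z) := by
        refine Finset.sum_le_sum fun z _ => ?_
        have w0 := resWt_nonneg α K a b z
        have w1 : resWt α K a b z ^ 2 ≤ 48 * resWt α K a b z := by
          nlinarith [resWt_le α K a b z]
        have pz := jb_pos z
        have pzq := jb_pos (z + (a + b))
        calc lamJ α K a b z ^ 2 = ((jb a)⁻¹ * (jb b)⁻¹) ^ 2 * (jb (a + b))⁻¹ *
              (jb (a + b) * ((jb z)⁻¹ ^ 2 * (jb (z + (a + b)))⁻¹ ^ 2)) *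
                resWt α K a b z ^ 2 := by
              rw [lamJ, add_comm (a + b) z]
              field_simp
          _ ≤ ((jb a)⁻¹ * (jb b)⁻¹) ^ 2 * (jb (a + b))⁻¹ *
              (6 * (poleWeight (a + b) z + poleWeight (a + b) (z + (a + b)))) *
                (48 * resWt α K a b z) := by
              have := jb_mul_inv_sq_le (a + b) z
              have n1 := poleWeight_nonneg (a + b) z
              have n2 := poleWeight_nonneg (a + b) (z + (a + b))
              gcongr
          _ = _ := by ring
    _ ≤ ((jb a)⁻¹ * (jb b)⁻¹) ^ 2 * (jb (a + b))⁻¹ * 288 *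
          (C * ((K : ℝ) + 1) ^ 2 * (jb (a + b))⁻¹) := by
        rw [← Finset.mul_sum]
        have := H K a ha b hb
        gcongr
    _ = _ := by ring

lemma sum_jb_inv_cube_shift_le {K J : ℕ} {p : Fin 3 → ℤ} (hp : p ∈ box (2 ^ J))
    (hJ : K ≤ J) : ∑ z ∈ box (2 ^ K), (jb (z + p))⁻¹ ^ 3 ≤ 216 * ((J : ℝ) + 3) := by
  have : ∑ z ∈ box (2 ^ K), (jb (z + p))⁻¹ ^ 3 ≤ ∑ z ∈ box (2 ^ (J + 1)), (jb z)⁻¹ ^ 3 := by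
    refine sum_box_shift_le (f := fun z => (jb z)⁻¹ ^ 3) (fun z hz => ?_)
      (fun z => by have := jb_pos z; positivity)
    refine box_mono ?_ (add_mem_box hz hp)
    have := Nat.pow_le_pow_right (n := 2) (by norm_num) hJ
    rw [pow_succ]; omega
  refine this.trans ((sum_jb_inv_cube_le _).trans (le_of_eq ?_))
  push_cast; ring

lemma sum_sum_jb_inv_sq_le (K : ℕ) :
    ∑ a ∈ box (2 ^ K), ∑ b ∈ box (2 ^ K), ((jb a)⁻¹ * (jb b)⁻¹ * (jb (a + b))⁻¹) ^ 2 ≤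
      (648 * ((K : ℝ) + 1)) ^ 2 := by
  have hK : (0 : ℝ) ≤ K := Nat.cast_nonneg K
  have s1 : ∑ z ∈ box (2 ^ K), (jb z)⁻¹ ^ 3 ≤ 648 * ((K : ℝ) + 1) :=
    (sum_jb_inv_cube_le K).trans (by linarith)
  have s2 : ∀ p ∈ box (2 ^ K), ∑ z ∈ box (2 ^ K), (jb (z + p))⁻¹ ^ 3 ≤ 648 * ((K : ℝ) + 1) :=
    fun p hp => (sum_jb_inv_cube_shift_le hp le_rfl).trans (by linarith)
  have nn : ∀ z, 0 ≤ (jb z)⁻¹ ^ 3 := fun z => by have := jb_pos z; positivity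
  set L := 648 * ((K : ℝ) + 1)
  have hL : 0 ≤ L := by positivity
  have t1 : ∑ a ∈ box (2 ^ K), ∑ b ∈ box (2 ^ K), (jb a)⁻¹ ^ 3 * (jb b)⁻¹ ^ 3 ≤ L ^ 2 := by
    rw [← Finset.sum_mul_sum, sq]
    exact mul_le_mul s1 s1 (Finset.sum_nonneg fun z _ => nn z) hL
  have t2 : ∑ a ∈ box (2 ^ K), ∑ b ∈ box (2 ^ K), (jb a)⁻¹ ^ 3 * (jb (b + a))⁻¹ ^ 3 ≤ L ^ 2 := by
    calc _ ≤ ∑ a ∈ box (2 ^ K), (jb a)⁻¹ ^ 3 * L := by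
          refine Finset.sum_le_sum fun a ha => ?_
          rw [← Finset.mul_sum]
          exact mul_le_mul_of_nonneg_left (s2 a ha) (nn a)
      _ ≤ L ^ 2 := by
          rw [← Finset.sum_mul, sq]
          exact mul_le_mul_of_nonneg_right s1 hL
  have t3 : ∑ a ∈ box (2 ^ K), ∑ b ∈ box (2 ^ K), (jb b)⁻¹ ^ 3 * (jb (a + b))⁻¹ ^ 3 ≤ L ^ 2 := by
    rw [Finset.sum_comm]; exact t2
  have hpt : ∀ a b : Fin 3 → ℤ, ((jb a)⁻¹ * (jb b)⁻¹ * (jb (a + b))⁻¹) ^ 2 ≤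
      1 / 3 * ((jb a)⁻¹ ^ 3 * (jb b)⁻¹ ^ 3) + 1 / 3 * ((jb a)⁻¹ ^ 3 * (jb (b + a))⁻¹ ^ 3) +
        1 / 3 * ((jb b)⁻¹ ^ 3 * (jb (a + b))⁻¹ ^ 3) := by
    intro a b
    rw [add_comm b a]
    have pa := inv_pos.2 (jb_pos a)
    have pb := inv_pos.2 (jb_pos b)
    have pq := inv_pos.2 (jb_pos (a + b))
    have amgm : ∀ p q r : ℝ, 0 ≤ p → 0 ≤ q → 0 ≤ r → 3 * (p * q * r) ≤ p ^ 3 + q ^ 3 + r ^ 3 :=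
      fun p q r hp hq hr => by
        nlinarith [mul_nonneg (add_nonneg (add_nonneg hp hq) hr)
          (add_nonneg (add_nonneg (sq_nonneg (p - q)) (sq_nonneg (q - r))) (sq_nonneg (r - p)))]
    have := amgm _ _ _ (mul_pos pa pb).le (mul_pos pa pq).le (mul_pos pb pq).le
    linarith
  calc _ ≤ ∑ a ∈ box (2 ^ K), ∑ b ∈ box (2 ^ K),
      (1 / 3 * ((jb a)⁻¹ ^ 3 * (jb b)⁻¹ ^ 3) + 1 / 3 * ((jb a)⁻¹ ^ 3 * (jb (b + a))⁻¹ ^ 3) +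
        1 / 3 * ((jb b)⁻¹ ^ 3 * (jb (a + b))⁻¹ ^ 3)) :=
        Finset.sum_le_sum fun a _ => Finset.sum_le_sum fun b _ => hpt a b
    _ ≤ L ^ 2 := by
        simp only [← Finset.mul_sum] at t1 t2
        simp only [Finset.sum_add_distrib, ← Finset.mul_sum]
        linarith

/-- Square-summability of the kernel, up to logarithms. -/
lemma sum_sum_sum_lamJ_sq_le {α : ℝ} (h1 : 1 < α) (h2 : α ≤ 2) :
    ∃ C : ℝ, 0 < C ∧ ∀ K : ℕ,
      ∑ a ∈ box (2 ^ K), ∑ b ∈ box (2 ^ K), ∑ c ∈ box (2 ^ K), lamJ α K a b c ^ 2 ≤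
        C * ((K : ℝ) + 1) ^ 4 := by
  obtain ⟨C, hC, H⟩ := sum_lamJ_sq_le h1 h2
  refine ⟨C * 648 ^ 2, by positivity, fun K => ?_⟩
  calc _ ≤ ∑ a ∈ box (2 ^ K), ∑ b ∈ box (2 ^ K),
        C * ((K : ℝ) + 1) ^ 2 * ((jb a)⁻¹ * (jb b)⁻¹ * (jb (a + b))⁻¹) ^ 2 :=
        Finset.sum_le_sum fun a ha => Finset.sum_le_sum fun b hb => H K a ha b hb
    _ ≤ C * ((K : ℝ) + 1) ^ 2 * (648 * ((K : ℝ) + 1)) ^ 2 := by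
        simp only [← Finset.mul_sum]
        have := sum_sum_jb_inv_sq_le K
        gcongr
    _ = _ := by ring

/-- Square-summability of the contracted kernel, up to logarithms. -/
lemma sum_sum_contract_sq_le {α : ℝ} (h1 : 1 < α) (h2 : α ≤ 2) :
    ∃ C : ℝ, 0 < C ∧ ∀ K : ℕ,
      ∑ a ∈ box (2 ^ K), ∑ b ∈ box (2 ^ K),
        (∑ z ∈ box (2 ^ K), lamJ α K a b z * (jb z)⁻¹) ^ 2 ≤ C * ((K : ℝ) + 1) ^ 6 := by
  obtain ⟨C, hC, H⟩ := sum_lamJ_mul_inv_le h1 h2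
  refine ⟨C ^ 2 * 648 ^ 2, by positivity, fun K => ?_⟩
  calc _ ≤ ∑ a ∈ box (2 ^ K), ∑ b ∈ box (2 ^ K),
        (C * ((K : ℝ) + 1) ^ 2) ^ 2 * ((jb a)⁻¹ * (jb b)⁻¹ * (jb (a + b))⁻¹) ^ 2 := by
        refine Finset.sum_le_sum fun a ha => Finset.sum_le_sum fun b hb => ?_
        rw [← mul_pow]
        exact pow_le_pow_left₀ (Finset.sum_nonneg fun z _ =>
          mul_nonneg (lamJ_nonneg _ _ _ _ _) (inv_nonneg.2 (jb_pos z).le)) (H K a ha b hb) 2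
    _ ≤ (C * ((K : ℝ) + 1) ^ 2) ^ 2 * (648 * ((K : ℝ) + 1)) ^ 2 := by
        simp only [← Finset.mul_sum]
        have := sum_sum_jb_inv_sq_le K
        gcongr
    _ = _ := by ring

lemma sum_jb_inv_mul_sq_le {K : ℕ} {p : Fin 3 → ℤ} (hp : p ∈ box (2 ^ (K + 3))) :
    ∑ z ∈ box (2 ^ K), (jb (z + p))⁻¹ * (jb z)⁻¹ ^ 2 ≤ 2000 * ((K : ℝ) + 1) := by
  have hK : (0 : ℝ) ≤ K := Nat.cast_nonneg K
  have s1 := sum_jb_inv_cube_le K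
  have s2 := sum_jb_inv_cube_shift_le hp (Nat.le_add_right K 3)
  push_cast at s2
  calc _ ≤ ∑ z ∈ box (2 ^ K), ((jb (z + p))⁻¹ ^ 3 + (jb z)⁻¹ ^ 3) := by
        refine Finset.sum_le_sum fun z _ => ?_
        have px := inv_pos.2 (jb_pos z)
        have py := inv_pos.2 (jb_pos (z + p))
        set x := (jb z)⁻¹
        set y := (jb (z + p))⁻¹
        rcases le_total x y with h | h
        · have : y * x ^ 2 ≤ y * y ^ 2 := by gcongr
          nlinarith [pow_pos px 3]
        · have : y * x ^ 2 ≤ x * x ^ 2 := by gcongr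
          nlinarith [pow_pos py 3]
    _ ≤ _ := by
        rw [Finset.sum_add_distrib]
        linarith

lemma resWt_swap_left (α : ℝ) (K : ℕ) (a b c : Fin 3 → ℤ) :
    resWt α K b a c = resWt α K a b c := by
  unfold resWt
  refine Fintype.sum_equiv (Equiv.arrowCongr (Equiv.swap 1 2) (Equiv.refl _)) _ _ fun e => ?_
  refine Finset.sum_congr rfl fun m _ => ?_
  have : kap α e b a c =
      kap α (Equiv.arrowCongr (Equiv.swap 1 2) (Equiv.refl Bool) e) a b c := by
    have h0 : Equiv.swap (1 : Fin 4) 2 0 = 0 := by decide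
    have h3 : Equiv.swap (1 : Fin 4) 2 3 = 3 := by decide
    simp only [kap, Equiv.arrowCongr_apply, Function.comp, Equiv.symm_swap, h0, h3,
      Equiv.swap_apply_left, Equiv.swap_apply_right, Equiv.refl_apply, add_comm b a]
    ring
  rw [this]

lemma resWt_swap_right (α : ℝ) (K : ℕ) (a b c : Fin 3 → ℤ) :
    resWt α K a c b = resWt α K a b c := by
  unfold resWt
  refine Fintype.sum_equiv (Equiv.arrowCongr (Equiv.swap 2 3) (Equiv.refl _)) _ _ fun e => ?_
  refine Finset.sum_congr rfl fun m _ => ?_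
  have : kap α e a c b =
      kap α (Equiv.arrowCongr (Equiv.swap 2 3) (Equiv.refl Bool) e) a b c := by
    have h0 : Equiv.swap (2 : Fin 4) 3 0 = 0 := by decide
    have h1 : Equiv.swap (2 : Fin 4) 3 1 = 1 := by decide
    simp only [kap, Equiv.arrowCongr_apply, Function.comp, Equiv.symm_swap, h0, h1,
      Equiv.swap_apply_left, Equiv.swap_apply_right, Equiv.refl_apply, add_right_comm a c b]
    ring
  rw [this]

lemma lamJ_swap_left (α : ℝ) (K : ℕ) (a b c : Fin 3 → ℤ) : lamJ α K b a c = lamJ α K a b c := by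
  rw [lamJ, lamJ, resWt_swap_left, add_comm b a, mul_comm (jb b)⁻¹]

lemma lamJ_swap_right (α : ℝ) (K : ℕ) (a b c : Fin 3 → ℤ) : lamJ α K a c b = lamJ α K a b c := by
  rw [lamJ, lamJ, resWt_swap_right, add_right_comm a c b, mul_right_comm (jb a)⁻¹]

lemma abs_sgn (s : Bool) : |sgn s| = 1 := by cases s <;> simp [sgn]

lemma abs_kap_le {α : ℝ} (h1 : 1 < α) (h2 : α ≤ 2) {K : ℕ} {a b c : Fin 3 → ℤ}
    (ha : a ∈ box (2 ^ K)) (hb : b ∈ box (2 ^ K)) (hc : c ∈ box (2 ^ K)) (e : Fin 4 → Bool) :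
    |kap α e a b c| ≤ 48 * (2 ^ K) ^ 2 := by
  have hs : ∀ (s : Bool) (n : Fin 3 → ℤ), |sgn s * jbb α n| ≤ jb n ^ 2 := fun s n => by
    rw [abs_mul, abs_sgn, one_mul, abs_of_pos (jbb_pos (by linarith) n), ← Real.rpow_natCast]
    exact (jbb_le (by linarith) n).trans
      (Real.rpow_le_rpow_of_exponent_le (one_le_jb n) (by exact_mod_cast h2))
  have ja := jb_le_of_mem_box ha
  have jb' := jb_le_of_mem_box hb
  have jc := jb_le_of_mem_box hc
  rw [pow_succ] at ja jb' jc
  have js : jb (a + b + c) ≤ 6 * 2 ^ K := by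
    linarith [jb_add_le (a + b) c, jb_add_le a b]
  have sq : ∀ {n : Fin 3 → ℤ} {t : ℝ}, jb n ≤ t → jb n ^ 2 ≤ t ^ 2 := fun {n t} h =>
    pow_le_pow_left₀ (jb_pos n).le h 2
  unfold kap
  refine (abs_add_le _ _).trans ?_
  have k1 := abs_add_le (sgn (e 0) * jbb α (a + b + c) + sgn (e 1) * jbb α a)
    (sgn (e 2) * jbb α b)
  have k2 := abs_add_le (sgn (e 0) * jbb α (a + b + c)) (sgn (e 1) * jbb α a)
  nlinarith [hs (e 0) (a + b + c), hs (e 1) a, hs (e 2) b, hs (e 3) c, sq ja, sq jb', sq jc, sq js]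

lemma Lam_eq {α : ℝ} (h1 : 1 < α) (h2 : α ≤ 2) {K : ℕ} {a b c : Fin 3 → ℤ}
    (ha : a ∈ box (2 ^ K)) (hb : b ∈ box (2 ^ K)) (hc : c ∈ box (2 ^ K)) :
    Lam α a b c = (jbb α (a + b + c))⁻¹ *
      ((jbb α a)⁻¹ * (jbb α b)⁻¹ * (jbb α c)⁻¹) * resWt α K a b c := by
  unfold Lam resWt
  rw [Finset.mul_sum]
  refine Finset.sum_congr rfl fun e _ => ?_
  rw [tsum_eq_sum (s := modRange K), Finset.mul_sum]
  · refine Finset.sum_congr rfl fun m _ => ?_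
    rw [kap]; ring
  · intro m hm
    have hk := abs_kap_le h1 h2 ha hb hc e
    have : ¬ |kap α e a b c - m| ≤ 1 := by
      intro h
      refine hm (Finset.mem_Icc.2 (abs_le.1 ?_))
      have h3 : |(m : ℝ)| ≤ 1 + 48 * (2 ^ K) ^ 2 := by
        have := abs_sub_abs_le_abs_sub (m : ℝ) (kap α e a b c)
        rw [abs_sub_comm] at this
        linarith
      have h4 : (1 : ℝ) ≤ (2 ^ K) ^ 2 := one_le_pow₀ (one_le_pow₀ (by norm_num))
      have h5 : |(m : ℝ)| ≤ 2 ^ (2 * K + 6) := by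
        rw [pow_add, mul_comm 2 K, pow_mul]
        linarith
      exact_mod_cast h5
    rw [kap] at this
    simp [ind, this]

lemma jbb_inv_le {α : ℝ} (h1 : 1 < α) (n : Fin 3 → ℤ) :
    (jbb α n)⁻¹ ≤ 2 * (jb n)⁻¹ * jb n ^ (-(α - 1)) := by
  have hp := jb_pos n
  have h := half_le_jbb (α := α) (by linarith) n
  have hq : 0 < jb n ^ α := Real.rpow_pos_of_pos hp _
  have e : 2 * (jb n)⁻¹ * jb n ^ (-(α - 1)) = (jb n ^ α / 2)⁻¹ := by
    rw [inv_div, div_eq_mul_inv, ← Real.rpow_neg hp.le, mul_assoc, ← Real.rpow_neg_one,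
      ← Real.rpow_add hp]
    congr 2; ring
  rw [e]
  exact inv_anti₀ (by positivity) h

lemma jb_rpow_neg_le_one {δ : ℝ} (hδ : 0 ≤ δ) (n : Fin 3 → ℤ) : jb n ^ (-δ) ≤ 1 :=
  Real.rpow_le_one_of_one_le_of_nonpos (one_le_jb n) (by linarith)

lemma Lam_nonneg (α : ℝ) (a b c : Fin 3 → ℤ) : 0 ≤ Lam α a b c := by
  unfold Lam
  refine Finset.sum_nonneg fun e _ => tsum_nonneg fun m => ?_
  have hn : ∀ n, 0 ≤ (jbb α n)⁻¹ := fun n => inv_nonneg.2 (Real.sqrt_nonneg _)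
  exact mul_nonneg (mul_nonneg (mul_nonneg (inv_nonneg.2 (rjb_pos m).le) (hn _))
    (mul_nonneg (mul_nonneg (hn _) (hn _)) (hn _))) (ind_nonneg _)

lemma Lam_le {α : ℝ} (h1 : 1 < α) (h2 : α ≤ 2) {K : ℕ} {a b c : Fin 3 → ℤ}
    (ha : a ∈ box (2 ^ K)) (hb : b ∈ box (2 ^ K)) (hc : c ∈ box (2 ^ K)) :
    Lam α a b c ≤ 16 * (jb a ^ (-(α - 1)) * jb b ^ (-(α - 1)) * jb c ^ (-(α - 1))) *
      lamJ α K a b c := by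
  rw [Lam_eq h1 h2 ha hb hc]
  have hw := resWt_nonneg α K a b c
  have hn : ∀ n, 0 ≤ (jbb α n)⁻¹ := fun n => inv_nonneg.2 (Real.sqrt_nonneg _)
  have hr : ∀ n : Fin 3 → ℤ, 0 ≤ jb n ^ (-(α - 1)) := fun n =>
    Real.rpow_nonneg (jb_pos n).le _
  have hj : ∀ n : Fin 3 → ℤ, 0 ≤ (jb n)⁻¹ := fun n => inv_nonneg.2 (jb_pos n).le
  have hs : (jbb α (a + b + c))⁻¹ ≤ 2 * (jb (a + b + c))⁻¹ := by
    refine (jbb_inv_le h1 _).trans ?_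
    have := jb_rpow_neg_le_one (by linarith : 0 ≤ α - 1) (a + b + c)
    exact mul_le_of_le_one_right (mul_nonneg (by norm_num) (hj _)) this
  calc _ ≤ 2 * (jb (a + b + c))⁻¹ * ((2 * (jb a)⁻¹ * jb a ^ (-(α - 1))) *
        (2 * (jb b)⁻¹ * jb b ^ (-(α - 1))) * (2 * (jb c)⁻¹ * jb c ^ (-(α - 1)))) *
          resWt α K a b c := by
        have ta := jbb_inv_le h1 a
        have tb := jbb_inv_le h1 b
        have tc := jbb_inv_le h1 c
        have na := hn a
        have nb := hn b
        have nc := hn c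
        have ns := hn (a + b + c)
        have ja := hj a
        have jb' := hj b
        have jc := hj c
        have js := hj (a + b + c)
        have ra := hr a
        have rb := hr b
        have rc := hr c
        gcongr
    _ = _ := by rw [lamJ]; ring

lemma znorm_le_jb (n : Fin 3 → ℤ) : znorm n ≤ jb n := Real.sqrt_le_sqrt (by linarith)

lemma half_le_jb_of_simFreq {N : ℝ} {n : Fin 3 → ℤ} (h : SimFreq N n) : N / 2 ≤ jb n := by
  rcases h with ⟨_, h, _⟩ | ⟨h, _⟩
  · exact h.le.trans (znorm_le_jb n)
  · linarith [one_le_jb n]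

lemma mem_box_of_simFreq {N : ℝ} {K : ℕ} {n : Fin 3 → ℤ} (hN : N ≤ 2 ^ K) (h : SimFreq N n) :
    n ∈ box (2 ^ K) := by
  have hz : znorm n ≤ 2 ^ K := by
    rcases h with ⟨_, _, h⟩ | ⟨_, h⟩
    · exact h.trans hN
    · exact h.trans (one_le_pow₀ (by norm_num))
  refine mem_box.2 fun i => ?_
  have : |(n i : ℝ)| ≤ znorm n := by
    refine Real.abs_le_sqrt ?_
    exact Finset.single_le_sum (f := fun i => (n i : ℝ) ^ 2) (fun i _ => sq_nonneg _)
      (Finset.mem_univ i)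
  exact_mod_cast this.trans hz

lemma jb_rpow_neg_le {δ : ℝ} (h0 : 0 ≤ δ) (h1 : δ ≤ 1) {N : ℝ} (hN : 0 < N) {n : Fin 3 → ℤ}
    (h : SimFreq N n) : jb n ^ (-δ) ≤ 2 * N ^ (-δ) := by
  calc jb n ^ (-δ) ≤ (N / 2) ^ (-δ) :=
        Real.rpow_le_rpow_of_nonpos (by positivity) (half_le_jb_of_simFreq h) (by linarith)
    _ = 2 ^ δ * N ^ (-δ) := by
        rw [Real.div_rpow hN.le (by norm_num), Real.rpow_neg (by norm_num : (0 : ℝ) ≤ 2),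
          div_inv_eq_mul, mul_comm]
    _ ≤ 2 * N ^ (-δ) := by
        have : (2 : ℝ) ^ δ ≤ 2 ^ (1 : ℝ) := Real.rpow_le_rpow_of_exponent_le (by norm_num) h1
        rw [Real.rpow_one] at this
        have := Real.rpow_nonneg hN.le (-δ)
        gcongr

/-- The summand, up to a gain in the largest frequency. -/
lemma summand_le {α : ℝ} (h1 : 1 < α) (h2 : α ≤ 2) {K : ℕ} {n : Fin 7 → Fin 3 → ℤ}
    (hn : ∀ j, n j ∈ box (2 ^ K)) {j₀ : Fin 7} (hj₀ : SimFreq (2 ^ K) (n j₀)) :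
    Lam α (n 0) (n 1) (n 2) * Lam α (n 3) (n 4) (n 5) * (jbb α (n 6))⁻¹ ≤
      1024 * ((2 : ℝ) ^ K) ^ (-(α - 1)) *
        (lamJ α K (n 0) (n 1) (n 2) * lamJ α K (n 3) (n 4) (n 5) * (jb (n 6))⁻¹) := by
  have hr : ∀ j, 0 ≤ jb (n j) ^ (-(α - 1)) := fun j => Real.rpow_nonneg (jb_pos _).le _
  have hprod : ∏ j, jb (n j) ^ (-(α - 1)) ≤ 2 * ((2 : ℝ) ^ K) ^ (-(α - 1)) := by
    rw [← Finset.mul_prod_erase _ _ (Finset.mem_univ j₀)]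
    refine (mul_le_of_le_one_right (hr j₀) (Finset.prod_le_one (fun j _ => hr j) fun j _ =>
      jb_rpow_neg_le_one (by linarith) _)).trans ?_
    exact jb_rpow_neg_le (by linarith) (by linarith) (by positivity) hj₀
  have l1 := Lam_le h1 h2 (hn 0) (hn 1) (hn 2)
  have l2 := Lam_le h1 h2 (hn 3) (hn 4) (hn 5)
  have l3 := jbb_inv_le h1 (n 6)
  have p1 := lamJ_nonneg α K (n 0) (n 1) (n 2)
  have p2 := lamJ_nonneg α K (n 3) (n 4) (n 5)
  have p3 : 0 ≤ (jb (n 6))⁻¹ := inv_nonneg.2 (jb_pos _).le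
  have p4 : 0 ≤ (jbb α (n 6))⁻¹ := inv_nonneg.2 (Real.sqrt_nonneg _)
  have q1 := (Lam_nonneg α (n 0) (n 1) (n 2)).trans l1
  have q2 := (Lam_nonneg α (n 3) (n 4) (n 5)).trans l2
  calc _ ≤ (16 * (jb (n 0) ^ (-(α - 1)) * jb (n 1) ^ (-(α - 1)) * jb (n 2) ^ (-(α - 1))) *
        lamJ α K (n 0) (n 1) (n 2)) *
        (16 * (jb (n 3) ^ (-(α - 1)) * jb (n 4) ^ (-(α - 1)) * jb (n 5) ^ (-(α - 1))) *
        lamJ α K (n 3) (n 4) (n 5)) * (2 * (jb (n 6))⁻¹ * jb (n 6) ^ (-(α - 1))) :=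
        mul_le_mul (mul_le_mul l1 l2 (Lam_nonneg _ _ _ _) q1) l3 p4 (mul_nonneg q1 q2)
    _ = (∏ j, jb (n j) ^ (-(α - 1))) * (512 *
        (lamJ α K (n 0) (n 1) (n 2) * lamJ α K (n 3) (n 4) (n 5) * (jb (n 6))⁻¹)) := by
        rw [Fin.prod_univ_seven]; ring
    _ ≤ (2 * ((2 : ℝ) ^ K) ^ (-(α - 1))) * (512 *
        (lamJ α K (n 0) (n 1) (n 2) * lamJ α K (n 3) (n 4) (n 5) * (jb (n 6))⁻¹)) := by
        gcongr
    _ = _ := by ring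

/-- Cauchy–Schwarz followed by a change of variables along an injective map. -/
lemma sum_sq_le_of_injective {ι κ U V : Type*} (F : Finset ι) (H : ι → Finset κ)
    (u : ι → κ → U) (v : ι → κ → V) (φ : U → ℝ) (ψ : V → ℝ) {W : ι → ℝ} {Φ : U → V → ℝ}
    (hW : ∀ f ∈ F, 0 ≤ W f) (hΦ : ∀ a b, 0 ≤ Φ a b) {TU : Finset U} {TV : Finset V}
    (hu : ∀ f ∈ F, ∀ g ∈ H f, u f g ∈ TU) (hv : ∀ f ∈ F, ∀ g ∈ H f, v f g ∈ TV)
    (hWΦ : ∀ f ∈ F, ∀ g ∈ H f, ∀ g' ∈ H f, W f ≤ Φ (u f g) (v f g'))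
    (hinj : ∀ f₁ ∈ F, ∀ f₂ ∈ F, ∀ g₁ ∈ H f₁, ∀ g₁' ∈ H f₁, ∀ g₂ ∈ H f₂, ∀ g₂' ∈ H f₂,
      u f₁ g₁ = u f₂ g₂ → v f₁ g₁' = v f₂ g₂' → f₁ = f₂ ∧ g₁ = g₂ ∧ g₁' = g₂') :
    ∑ f ∈ F, W f * (∑ g ∈ H f, φ (u f g) * ψ (v f g)) ^ 2 ≤
      ∑ a ∈ TU, ∑ b ∈ TV, Φ a b * φ a ^ 2 * ψ b ^ 2 := by
  classical
  set Ψ : U × V → ℝ := fun x => Φ x.1 x.2 * φ x.1 ^ 2 * ψ x.2 ^ 2 with hΨ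
  set S : Finset (Σ _ : ι, κ × κ) := F.sigma fun f => H f ×ˢ H f with hS
  set T : (Σ _ : ι, κ × κ) → U × V := fun x => (u x.1 x.2.1, v x.1 x.2.2) with hT
  have hmem : ∀ x ∈ S, x.1 ∈ F ∧ x.2.1 ∈ H x.1 ∧ x.2.2 ∈ H x.1 := fun x hx => by
    simpa [hS] using hx
  have hTinj : Set.InjOn T S := by
    rintro ⟨f₁, g₁, g₁'⟩ h₁ ⟨f₂, g₂, g₂'⟩ h₂ h
    obtain ⟨a1, a2, a3⟩ := hmem _ h₁
    obtain ⟨b1, b2, b3⟩ := hmem _ h₂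
    obtain ⟨rfl, rfl, rfl⟩ := hinj f₁ a1 f₂ b1 g₁ a2 g₁' a3 g₂ b2 g₂' b3
      (congrArg Prod.fst h) (congrArg Prod.snd h)
    rfl
  calc ∑ f ∈ F, W f * (∑ g ∈ H f, φ (u f g) * ψ (v f g)) ^ 2
      ≤ ∑ f ∈ F, W f * ((∑ g ∈ H f, φ (u f g) ^ 2) * ∑ g ∈ H f, ψ (v f g) ^ 2) :=
        Finset.sum_le_sum fun f hf =>
          mul_le_mul_of_nonneg_left (Finset.sum_mul_sq_le_sq_mul_sq _ _ _) (hW f hf)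
    _ = ∑ x ∈ S, W x.1 * (φ (T x).1 ^ 2 * ψ (T x).2 ^ 2) := by
        rw [hS, Finset.sum_sigma]
        refine Finset.sum_congr rfl fun f _ => ?_
        rw [Finset.sum_mul_sum, Finset.mul_sum, Finset.sum_product]
        exact Finset.sum_congr rfl fun g _ => by rw [Finset.mul_sum]
    _ ≤ ∑ x ∈ S, Ψ (T x) := by
        refine Finset.sum_le_sum fun x hx => ?_
        obtain ⟨a1, a2, a3⟩ := hmem x hx
        simp only [hΨ]
        rw [mul_assoc]
        exact mul_le_mul_of_nonneg_right (hWΦ _ a1 _ a2 _ a3) (by positivity)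
    _ = ∑ y ∈ S.image T, Ψ y := (Finset.sum_image hTinj).symm
    _ ≤ ∑ y ∈ TU ×ˢ TV, Ψ y := by
        refine Finset.sum_le_sum_of_subset_of_nonneg ?_ fun y _ _ => ?_
        · intro y hy
          obtain ⟨x, hx, rfl⟩ := Finset.mem_image.1 hy
          obtain ⟨a1, a2, a3⟩ := hmem x hx
          exact Finset.mem_product.2 ⟨hu _ a1 _ a2, hv _ a1 _ a3⟩
        · have := hΦ y.1 y.2
          simp only [hΨ]; positivity
    _ = _ := by rw [Finset.sum_product]

/-- `n` satisfies the constraints of the pairing. -/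
def Pairing.Adm {J : ℕ} (P : Pairing J) (n : Fin J → Fin 3 → ℤ) : Prop :=
  ∀ i j, P.rel i j → n i + n j = 0

open Classical in
/-- The tuple with unpaired entries `f` and paired entries `g`. -/
def Pairing.merge {J : ℕ} (P : Pairing J) (f : {j : Fin J // ¬P.Paired j} → Fin 3 → ℤ)
    (g : {j : Fin J // P.Paired j} → Fin 3 → ℤ) : Fin J → Fin 3 → ℤ :=
  fun j => if h : P.Paired j then g ⟨j, h⟩ else f ⟨j, h⟩

namespace Pairing

variable {J : ℕ} (P : Pairing J)

lemma merge_of_paired {j : Fin J} (h : P.Paired j) (f g) : P.merge f g j = g ⟨j, h⟩ := by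
  simp [merge, h]

lemma merge_of_not_paired {j : Fin J} (h : ¬P.Paired j) (f g) : P.merge f g j = f ⟨j, h⟩ := by
  simp [merge, h]

lemma Adm.eq_neg {P : Pairing J} {n} (h : P.Adm n) {i j : Fin J} (hij : P.rel i j) :
    n j = -n i := eq_neg_of_add_eq_zero_right (h i j hij)

/-- Admissible paired entries are determined by their values on a set meeting every pair. -/
lemma merge_right_ext {f₁ f₂ g₁ g₂} (h₁ : P.Adm (P.merge f₁ g₁)) (h₂ : P.Adm (P.merge f₂ g₂))
    (h : ∀ i j, P.rel i j → P.merge f₁ g₁ i = P.merge f₂ g₂ i ∨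
      P.merge f₁ g₁ j = P.merge f₂ g₂ j) : g₁ = g₂ := by
  funext ⟨i, hi⟩
  rw [← P.merge_of_paired hi f₁ g₁, ← P.merge_of_paired hi f₂ g₂]
  obtain ⟨j, hij⟩ := hi
  rcases h i j hij with h | h
  · exact h
  · rw [h₁.eq_neg (P.symm _ _ hij), h₂.eq_neg (P.symm _ _ hij), h]

lemma merge_left_ext {f₁ f₂ g₁ g₂}
    (h : ∀ j, ¬P.Paired j → P.merge f₁ g₁ j = P.merge f₂ g₂ j) : f₁ = f₂ := by
  funext ⟨j, hj⟩
  rw [← P.merge_of_not_paired hj f₁ g₁, ← P.merge_of_not_paired hj f₂ g₂, h j hj]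

/-- The tuples of unpaired frequencies in the cube. -/
def freeBox (R : ℕ) : Finset ({j : Fin J // ¬P.Paired j} → Fin 3 → ℤ) := by
  classical exact Fintype.piFinset fun _ => box R

open Classical in
/-- The admissible tuples of paired frequencies in the cube. -/
def pairBox (R : ℕ) (f : {j : Fin J // ¬P.Paired j} → Fin 3 → ℤ) :
    Finset ({j : Fin J // P.Paired j} → Fin 3 → ℤ) :=
  (Fintype.piFinset fun _ => box R).filter fun g => P.Adm (P.merge f g)

lemma mem_freeBox {R : ℕ} {f} : f ∈ P.freeBox R ↔ ∀ j, f j ∈ box R := by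
  simp [freeBox]

lemma mem_pairBox {R : ℕ} {f g} :
    g ∈ P.pairBox R f ↔ (∀ j, g j ∈ box R) ∧ P.Adm (P.merge f g) := by
  simp [pairBox]

lemma merge_mem_box {R : ℕ} {f g} (hf : f ∈ P.freeBox R) (hg : ∀ j, g j ∈ box R) (j : Fin J) :
    P.merge f g j ∈ box R := by
  by_cases h : P.Paired j
  · rw [P.merge_of_paired h]; exact hg _
  · rw [P.merge_of_not_paired h]; exact P.mem_freeBox.1 hf _

end Pairing

namespace Pairing

variable (P : Pairing 7)

open Classical in
/-- The admissible tuples of paired frequencies vanishing at `p` and at the last index. -/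
def redBox (R : ℕ) (p : Fin 7) (f : {j : Fin 7 // ¬P.Paired j} → Fin 3 → ℤ) :
    Finset ({j : Fin 7 // P.Paired j} → Fin 3 → ℤ) :=
  (P.pairBox R f).filter fun h => P.merge f h p = 0 ∧ P.merge f h 6 = 0

open Classical in
/-- Erasing the entries at `p` and at the last index. -/
def erasePair (p : Fin 7) (g : {j : Fin 7 // P.Paired j} → Fin 3 → ℤ) :
    {j : Fin 7 // P.Paired j} → Fin 3 → ℤ :=
  fun j => if (j : Fin 7) = p ∨ (j : Fin 7) = 6 then 0 else g j

lemma merge_erasePair_of_ne {p j : Fin 7} (hp : j ≠ p) (h6 : j ≠ 6) (f g) :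
    P.merge f (P.erasePair p g) j = P.merge f g j := by
  by_cases h : P.Paired j
  · rw [P.merge_of_paired h, P.merge_of_paired h]
    simp [erasePair, hp, h6]
  · rw [P.merge_of_not_paired h, P.merge_of_not_paired h]

lemma merge_erasePair_of_eq {p j : Fin 7} (h : P.Paired j) (hj : j = p ∨ j = 6) (f g) :
    P.merge f (P.erasePair p g) j = 0 := by
  rw [P.merge_of_paired h]
  simp [erasePair, hj]

lemma erasePair_mem_redBox {p : Fin 7} (hp : P.rel p 6) {R : ℕ} {f g} (hg : g ∈ P.pairBox R f) :
    P.erasePair p g ∈ P.redBox R p f := by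
  classical
  obtain ⟨hg1, hg2⟩ := P.mem_pairBox.1 hg
  have hp' : P.Paired p := ⟨6, hp⟩
  have h6' : P.Paired 6 := ⟨p, P.symm _ _ hp⟩
  refine Finset.mem_filter.2 ⟨P.mem_pairBox.2 ⟨fun j => ?_, fun i j hij => ?_⟩,
    P.merge_erasePair_of_eq hp' (Or.inl rfl) f g, P.merge_erasePair_of_eq h6' (Or.inr rfl) f g⟩
  · unfold erasePair
    split_ifs
    · exact mem_box.2 fun i => by simp
    · exact hg1 j
  · by_cases hi : i = p ∨ i = 6
    · have hj : j = p ∨ j = 6 := by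
        rcases hi with rfl | rfl
        · exact Or.inr (P.univalent _ _ _ hij hp)
        · exact Or.inl (P.univalent _ _ _ hij (P.symm _ _ hp))
      rw [P.merge_erasePair_of_eq ⟨j, hij⟩ hi, P.merge_erasePair_of_eq ⟨i, P.symm _ _ hij⟩ hj,
        add_zero]
    · have hj : ¬(j = p ∨ j = 6) := by
        rintro (rfl | rfl)
        · exact hi (Or.inr (P.univalent _ _ _ (P.symm _ _ hij) hp))
        · exact hi (Or.inl (P.univalent _ _ _ (P.symm _ _ hij) (P.symm _ _ hp)))
      rw [not_or] at hi hj
      rw [P.merge_erasePair_of_ne hi.1 hi.2, P.merge_erasePair_of_ne hj.1 hj.2]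
      exact hg2 i j hij

/-- Summing out the pair `(p, 6)`. -/
lemma sum_fiber_erasePair_le {p : Fin 7} (hp : P.rel p 6) {R : ℕ} {f}
    (hf : f ∈ P.freeBox R) (h : {j : Fin 7 // P.Paired j} → Fin 3 → ℤ) {χ : (Fin 3 → ℤ) → ℝ}
    (hχ : ∀ z, 0 ≤ χ z) [DecidablePred fun g => P.erasePair p g = h] :
    ∑ g ∈ (P.pairBox R f).filter (fun g => P.erasePair p g = h), χ (P.merge f g p) ≤
      ∑ z ∈ box R, χ z := by
  classical
  have hinj : Set.InjOn (fun g => P.merge f g p)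
      ((P.pairBox R f).filter (fun g => P.erasePair p g = h)) := by
    intro g₁ h₁ g₂ h₂ he
    obtain ⟨a1, a2⟩ := Finset.mem_filter.1 h₁
    obtain ⟨b1, b2⟩ := Finset.mem_filter.1 h₂
    have ha := (P.mem_pairBox.1 a1).2
    have hb := (P.mem_pairBox.1 b1).2
    refine P.merge_right_ext (f₁ := f) (f₂ := f) ha hb fun i j _ => Or.inl ?_
    by_cases hip : i = p
    · rw [hip]; exact he
    by_cases hi6 : i = 6
    · rw [hi6, ha.eq_neg hp, hb.eq_neg hp]; exact congrArg Neg.neg he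
    rw [← P.merge_erasePair_of_ne hip hi6, a2, ← b2, P.merge_erasePair_of_ne hip hi6]
  rw [← Finset.sum_image (g := fun g => P.merge f g p) hinj]
  refine Finset.sum_le_sum_of_subset_of_nonneg ?_ fun z _ _ => hχ z
  intro z hz
  obtain ⟨g, hg, rfl⟩ := Finset.mem_image.1 hz
  exact P.merge_mem_box hf (P.mem_pairBox.1 (Finset.mem_filter.1 hg).1).1 p

/-- The estimate when the last index is paired with `p`. -/
lemma sum_sq_le_of_rel_six (α : ℝ) (K : ℕ) {i₀ i₁ i₂ j₀ j₁ p : Fin 7}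
    (hcov : ∀ j, j = i₀ ∨ j = i₁ ∨ j = i₂ ∨ j = j₀ ∨ j = j₁ ∨ j = p ∨ j = 6)
    (hI : ∀ i j, P.rel i j → (i = i₀ ∨ i = i₁ ∨ i = i₂) → (j = i₀ ∨ j = i₁ ∨ j = i₂) → False)
    (hJ : ∀ i j, P.rel i j → (i = j₀ ∨ i = j₁) → (j = j₀ ∨ j = j₁) → False)
    (hd : ∀ i, i = i₀ ∨ i = i₁ ∨ i = i₂ ∨ i = j₀ ∨ i = j₁ → i ≠ p ∧ i ≠ 6)
    (hp : P.rel p 6) :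
    ∑ f ∈ P.freeBox (2 ^ K), (∑ g ∈ P.pairBox (2 ^ K) f,
        lamJ α K (P.merge f g i₀) (P.merge f g i₁) (P.merge f g i₂) *
          (lamJ α K (P.merge f g j₀) (P.merge f g j₁) (P.merge f g p) *
            (jb (P.merge f g 6))⁻¹)) ^ 2 ≤
      (∑ a ∈ box (2 ^ K), ∑ b ∈ box (2 ^ K), ∑ c ∈ box (2 ^ K), lamJ α K a b c ^ 2) *
        ∑ a ∈ box (2 ^ K), ∑ b ∈ box (2 ^ K),
          (∑ z ∈ box (2 ^ K), lamJ α K a b z * (jb z)⁻¹) ^ 2 := by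
  classical
  set φ : (Fin 3 → ℤ) × (Fin 3 → ℤ) × (Fin 3 → ℤ) → ℝ := fun x => lamJ α K x.1 x.2.1 x.2.2
    with hφ
  set ψ : (Fin 3 → ℤ) × (Fin 3 → ℤ) → ℝ := fun x =>
    ∑ z ∈ box (2 ^ K), lamJ α K x.1 x.2 z * (jb z)⁻¹ with hψ
  have hterm : ∀ z x y, 0 ≤ lamJ α K x y z * (jb z)⁻¹ := fun z x y =>
    mul_nonneg (lamJ_nonneg _ _ _ _ _) (inv_nonneg.2 (jb_pos z).le)
  have hp' : P.Paired p := ⟨6, hp⟩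
  have h6' : P.Paired 6 := ⟨p, P.symm _ _ hp⟩
  have key := sum_sq_le_of_injective (P.freeBox (2 ^ K)) (P.redBox (2 ^ K) p)
    (fun f g => (P.merge f g i₀, P.merge f g i₁, P.merge f g i₂))
    (fun f g => (P.merge f g j₀, P.merge f g j₁)) φ ψ (W := fun _ => 1) (Φ := fun _ _ => 1)
    (fun _ _ => zero_le_one) (fun _ _ => zero_le_one)
    (TU := box (2 ^ K) ×ˢ box (2 ^ K) ×ˢ box (2 ^ K)) (TV := box (2 ^ K) ×ˢ box (2 ^ K))
    (fun f hf g hg => by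
      have := P.merge_mem_box hf (P.mem_pairBox.1 (Finset.mem_filter.1 hg).1).1
      simp only [Finset.mem_product]
      exact ⟨this _, this _, this _⟩)
    (fun f hf g hg => by
      have := P.merge_mem_box hf (P.mem_pairBox.1 (Finset.mem_filter.1 hg).1).1
      simp only [Finset.mem_product]
      exact ⟨this _, this _⟩)
    (fun _ _ _ _ _ _ => le_rfl) ?_
  · refine le_trans ?_ (key.trans (le_of_eq ?_))
    · refine Finset.sum_le_sum fun f hf => ?_
      rw [one_mul]
      refine pow_le_pow_left₀ (Finset.sum_nonneg fun g _ => mul_nonneg (lamJ_nonneg _ _ _ _ _)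
        (mul_nonneg (lamJ_nonneg _ _ _ _ _) (inv_nonneg.2 (jb_pos _).le))) ?_ 2
      rw [← Finset.sum_fiberwise_of_maps_to (t := P.redBox (2 ^ K) p f)
        (fun g hg => P.erasePair_mem_redBox hp hg)]
      refine Finset.sum_le_sum fun h hh => ?_
      calc _ = φ (P.merge f h i₀, P.merge f h i₁, P.merge f h i₂) *
            ∑ g ∈ (P.pairBox (2 ^ K) f).filter (fun g => P.erasePair p g = h),
              (fun z => lamJ α K (P.merge f h j₀) (P.merge f h j₁) z * (jb z)⁻¹)
                (P.merge f g p) := by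
            rw [Finset.mul_sum]
            refine Finset.sum_congr rfl fun g hg => ?_
            obtain ⟨hg1, hg2⟩ := Finset.mem_filter.1 hg
            have ee : ∀ j, j = i₀ ∨ j = i₁ ∨ j = i₂ ∨ j = j₀ ∨ j = j₁ →
                P.merge f h j = P.merge f g j := fun j hj => by
              rw [← hg2, P.merge_erasePair_of_ne (hd j hj).1 (hd j hj).2]
            rw [(P.mem_pairBox.1 hg1).2.eq_neg hp, jb_neg, ee i₀ (by simp), ee i₁ (by simp),
              ee i₂ (by simp), ee j₀ (by simp), ee j₁ (by simp)]
        _ ≤ _ := mul_le_mul_of_nonneg_left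
            (P.sum_fiber_erasePair_le hp hf h fun z => hterm z _ _) (lamJ_nonneg _ _ _ _ _)
    · simp only [one_mul, ← Finset.mul_sum, ← Finset.sum_mul, Finset.sum_product, hφ, hψ]
  · intro f₁ _ f₂ _ g₁ h₁ g₁' h₁' g₂ h₂ g₂' h₂' hu hv
    simp only [Prod.mk.injEq] at hu hv
    obtain ⟨u0, u1, u2⟩ := hu
    obtain ⟨v0, v1⟩ := hv
    obtain ⟨a1, a2, a3⟩ := Finset.mem_filter.1 h₁
    obtain ⟨b1, b2, b3⟩ := Finset.mem_filter.1 h₁'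
    obtain ⟨c1, c2, c3⟩ := Finset.mem_filter.1 h₂
    obtain ⟨d1, d2, d3⟩ := Finset.mem_filter.1 h₂'
    have eI : ∀ j, (j = i₀ ∨ j = i₁ ∨ j = i₂) → P.merge f₁ g₁ j = P.merge f₂ g₂ j := by
      rintro j (rfl | rfl | rfl) <;> assumption
    have eJ : ∀ j, (j = j₀ ∨ j = j₁) → P.merge f₁ g₁' j = P.merge f₂ g₂' j := by
      rintro j (rfl | rfl) <;> assumption
    have eZ : ∀ j, (j = p ∨ j = 6) → P.merge f₁ g₁ j = P.merge f₂ g₂ j ∧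
        P.merge f₁ g₁' j = P.merge f₂ g₂' j := by
      rintro j (rfl | rfl)
      · exact ⟨a2.trans c2.symm, b2.trans d2.symm⟩
      · exact ⟨a3.trans c3.symm, b3.trans d3.symm⟩
    have cov : ∀ j, (j = i₀ ∨ j = i₁ ∨ j = i₂) ∨ (j = j₀ ∨ j = j₁) ∨ (j = p ∨ j = 6) := by
      intro j; have := hcov j; tauto
    refine ⟨P.merge_left_ext (g₁ := fun _ => 0) (g₂ := fun _ => 0) fun j hj => ?_,
      P.merge_right_ext (P.mem_pairBox.1 a1).2 (P.mem_pairBox.1 c1).2 fun i j hij => ?_,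
      P.merge_right_ext (P.mem_pairBox.1 b1).2 (P.mem_pairBox.1 d1).2 fun i j hij => ?_⟩
    · rcases cov j with h | h | h
      · have := eI j h
        rwa [P.merge_of_not_paired hj, P.merge_of_not_paired hj] at this ⊢
      · have := eJ j h
        rwa [P.merge_of_not_paired hj, P.merge_of_not_paired hj] at this ⊢
      · rcases h with rfl | rfl
        · exact absurd hp' hj
        · exact absurd h6' hj
    · rcases cov i with h | h | h
      · exact Or.inl (eI i h)
      · rcases cov j with h' | h' | h'
        · exact Or.inr (eI j h')
        · exact absurd h' (fun h' => hJ i j hij h h')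
        · exact Or.inr (eZ j h').1
      · exact Or.inl (eZ i h).1
    · rcases cov i with h | h | h
      · rcases cov j with h' | h' | h'
        · exact absurd h' (fun h' => hI i j hij h h')
        · exact Or.inr (eJ j h')
        · exact Or.inr (eZ j h').2
      · exact Or.inl (eJ i h)
      · exact Or.inl (eZ i h).2

end Pairing

section

variable {β : Type*} {n m : Fin 7 → β}

lemma eq_vecCons_of_eq {x : β} {j : Fin 7} (h₁ : n j = x) (h₂ : m j = x) :
    x = ![n 0, n 1, n 2, m 3, m 4, m 5, m 6] j := by
  fin_cases j <;> first | simpa using h₁.symm | simpa using h₂.symm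

lemma vecCons_castSucc_eq (a b c d e k l l' : β) (i : Fin 6) :
    ![a, b, c, d, e, k, l] i.castSucc = ![a, b, c, d, e, k, l'] i.castSucc := by
  fin_cases i <;> simp

lemma eq_of_div_three_eq_zero (h0 : n 0 = m 0) (h1 : n 1 = m 1) (h2 : n 2 = m 2) {j : Fin 7}
    (hj : (j : ℕ) / 3 = 0) : n j = m j := by
  fin_cases j <;> first | assumption | simp at hj

lemma eq_of_div_three_ne_zero (h3 : n 3 = m 3) (h4 : n 4 = m 4) (h5 : n 5 = m 5)
    (h6 : n 6 = m 6) {j : Fin 7} (hj : (j : ℕ) / 3 ≠ 0) : n j = m j := by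
  fin_cases j <;> first | assumption | simp at hj

end

namespace Pairing

variable (P : Pairing 7)

open Classical in
/-- If the last index is unpaired, the unpaired entries sum to the last one plus the others. -/
lemma sum_unpaired_eq (h6 : ¬P.Paired 6) (n : Fin 7 → Fin 3 → ℤ) :
    ∑ j : {j : Fin 7 // ¬P.Paired j}, n j =
      n 6 + ∑ i : Fin 6, if P.Paired i.castSucc then 0 else n i.castSucc := by
  rw [← Finset.sum_subtype (Finset.univ.filter fun j => ¬P.Paired j) (by simp) n,
    Finset.sum_filter, Fin.sum_univ_castSucc, add_comm]
  have h : ¬P.Paired (Fin.last 6) := h6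
  rw [if_pos h]
  congr 1
  exact Finset.sum_congr rfl fun i _ => by rw [ite_not]

open Classical in
lemma sum_castSucc_mem_box {K : ℕ} {n : Fin 7 → Fin 3 → ℤ}
    (hn : ∀ i : Fin 6, n i.castSucc ∈ box (2 ^ K)) :
    (∑ i : Fin 6, if P.Paired i.castSucc then 0 else n i.castSucc) ∈ box (2 ^ (K + 3)) := by
  refine mem_box.2 fun k => ?_
  rw [Finset.sum_apply]
  calc _ ≤ ∑ i : Fin 6, |(if P.Paired i.castSucc then 0 else n i.castSucc) k| :=
        Finset.abs_sum_le_sum_abs _ _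
    _ ≤ ∑ _i : Fin 6, (2 : ℤ) ^ K := Finset.sum_le_sum fun i _ => by
        split_ifs
        · simp
        · exact_mod_cast mem_box.1 (hn i) k
    _ ≤ ((2 ^ (K + 3) : ℕ) : ℤ) := by
        simp only [Finset.sum_const, Finset.card_univ, Fintype.card_fin]
        push_cast
        rw [pow_add]
        have : (0 : ℤ) < 2 ^ K := by positivity
        simp only [nsmul_eq_mul]; push_cast; linarith

/-- The estimate when the last index is unpaired. -/
lemma sum_sq_le_of_not_paired_six (hres : ∀ i j : Fin 7, P.rel i j → (i : ℕ) / 3 ≠ (j : ℕ) / 3)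
    (α : ℝ) (K : ℕ) (h6 : ¬P.Paired 6) [Fintype {j : Fin 7 // ¬P.Paired j}] :
    ∑ f ∈ P.freeBox (2 ^ K), (jb (∑ j, f j))⁻¹ * (∑ g ∈ P.pairBox (2 ^ K) f,
        lamJ α K (P.merge f g 0) (P.merge f g 1) (P.merge f g 2) *
          (lamJ α K (P.merge f g 3) (P.merge f g 4) (P.merge f g 5) *
            (jb (P.merge f g 6))⁻¹)) ^ 2 ≤
      2000 * ((K : ℝ) + 1) *
        (∑ a ∈ box (2 ^ K), ∑ b ∈ box (2 ^ K), ∑ c ∈ box (2 ^ K), lamJ α K a b c ^ 2) ^ 2 := by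
  classical
  set B := box (2 ^ K) with hB
  set comb : (Fin 3 → ℤ) × (Fin 3 → ℤ) × (Fin 3 → ℤ) →
      (Fin 3 → ℤ) × (Fin 3 → ℤ) × (Fin 3 → ℤ) × (Fin 3 → ℤ) → Fin 7 → Fin 3 → ℤ :=
    fun a b => ![a.1, a.2.1, a.2.2, b.1, b.2.1, b.2.2.1, b.2.2.2] with hcomb
  have key := sum_sq_le_of_injective (P.freeBox (2 ^ K)) (P.pairBox (2 ^ K))
    (fun f g => (P.merge f g 0, P.merge f g 1, P.merge f g 2))
    (fun f g => (P.merge f g 3, P.merge f g 4, P.merge f g 5, P.merge f g 6))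
    (fun x => lamJ α K x.1 x.2.1 x.2.2) (fun x => lamJ α K x.1 x.2.1 x.2.2.1 * (jb x.2.2.2)⁻¹)
    (W := fun f => (jb (∑ j, f j))⁻¹)
    (Φ := fun a b => (jb (∑ j : {j : Fin 7 // ¬P.Paired j}, comb a b j))⁻¹)
    (fun _ _ => inv_nonneg.2 (jb_pos _).le) (fun _ _ => inv_nonneg.2 (jb_pos _).le)
    (TU := B ×ˢ B ×ˢ B) (TV := B ×ˢ B ×ˢ B ×ˢ B)
    (fun f hf g hg => by
      have := P.merge_mem_box hf (P.mem_pairBox.1 hg).1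
      simp only [Finset.mem_product]
      exact ⟨this _, this _, this _⟩)
    (fun f hf g hg => by
      have := P.merge_mem_box hf (P.mem_pairBox.1 hg).1
      simp only [Finset.mem_product]
      exact ⟨this _, this _, this _, this _⟩)
    ?_ ?_
  · refine key.trans ?_
    have inner : ∀ a ∈ B ×ˢ B ×ˢ B, ∀ d ∈ B, ∀ e ∈ B, ∀ k ∈ B,
        ∑ l ∈ B, (jb (∑ j : {j : Fin 7 // ¬P.Paired j}, comb a (d, e, k, l) j))⁻¹ *
            lamJ α K a.1 a.2.1 a.2.2 ^ 2 * (lamJ α K d e k * (jb l)⁻¹) ^ 2 ≤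
          lamJ α K a.1 a.2.1 a.2.2 ^ 2 * (lamJ α K d e k ^ 2 * (2000 * ((K : ℝ) + 1))) := by
      intro a ha d hd e he k hk
      simp only [Finset.mem_product] at ha
      set q := ∑ i : Fin 6, if P.Paired i.castSucc then 0 else comb a (d, e, k, 0) i.castSucc
        with hq
      have hqB : q ∈ box (2 ^ (K + 3)) := P.sum_castSucc_mem_box fun i => by
        fin_cases i <;> simp [hcomb] <;> tauto
      have hsum : ∀ l, ∑ j : {j : Fin 7 // ¬P.Paired j}, comb a (d, e, k, l) j = l + q := by
        intro l
        have hlast : comb a (d, e, k, l) 6 = l := rfl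
        have hcast : ∀ i : Fin 6,
            comb a (d, e, k, l) i.castSucc = comb a (d, e, k, 0) i.castSucc :=
          vecCons_castSucc_eq _ _ _ _ _ _ _ _
        have h := P.sum_unpaired_eq h6 (comb a (d, e, k, l))
        simp only [hcast, hlast, ← hq] at h
        rw [← h]
        exact Finset.sum_congr (by ext; simp) fun _ _ => rfl
      calc _ = lamJ α K a.1 a.2.1 a.2.2 ^ 2 * (lamJ α K d e k ^ 2 *
            ∑ l ∈ B, (jb (l + q))⁻¹ * (jb l)⁻¹ ^ 2) := by
            rw [Finset.mul_sum, Finset.mul_sum]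
            refine Finset.sum_congr rfl fun l _ => ?_
            rw [hsum]; ring
        _ ≤ _ := by gcongr; exact sum_jb_inv_mul_sq_le hqB
    calc _ ≤ ∑ a ∈ B ×ˢ B ×ˢ B, ∑ d ∈ B, ∑ e ∈ B, ∑ k ∈ B,
          lamJ α K a.1 a.2.1 a.2.2 ^ 2 * (lamJ α K d e k ^ 2 * (2000 * ((K : ℝ) + 1))) := by
          refine Finset.sum_le_sum fun a ha => ?_
          simp only [Finset.sum_product]
          exact Finset.sum_le_sum fun d hd => Finset.sum_le_sum fun e he =>
            Finset.sum_le_sum fun k hk => inner a ha d hd e he k hk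
      _ = _ := by
          simp only [← Finset.mul_sum, ← Finset.sum_mul, Finset.sum_product]
          ring
  · intro f _ g _ g' _
    refine le_of_eq ?_
    congr 2
    refine Finset.sum_congr rfl fun j _ => ?_
    exact eq_vecCons_of_eq (P.merge_of_not_paired j.2 f g) (P.merge_of_not_paired j.2 f g')
  · intro f₁ _ f₂ _ g₁ h₁ g₁' h₁' g₂ h₂ g₂' h₂' hu hv
    simp only [Prod.mk.injEq] at hu hv
    obtain ⟨u0, u1, u2⟩ := hu
    obtain ⟨v0, v1, v2, v3⟩ := hv
    have eI : ∀ j : Fin 7, (j : ℕ) / 3 = 0 → P.merge f₁ g₁ j = P.merge f₂ g₂ j :=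
      fun j hj => eq_of_div_three_eq_zero u0 u1 u2 hj
    have eJ : ∀ j : Fin 7, (j : ℕ) / 3 ≠ 0 → P.merge f₁ g₁' j = P.merge f₂ g₂' j :=
      fun j hj => eq_of_div_three_ne_zero v0 v1 v2 v3 hj
    have hlt : ∀ j, P.Paired j → (j : ℕ) / 3 ≤ 1 := by
      intro j hj
      have : j ≠ 6 := by rintro rfl; exact h6 hj
      omega
    refine ⟨P.merge_left_ext (g₁ := fun _ => 0) (g₂ := fun _ => 0) fun j hj => ?_,
      P.merge_right_ext (P.mem_pairBox.1 h₁).2 (P.mem_pairBox.1 h₂).2 fun i j hij => ?_,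
      P.merge_right_ext (P.mem_pairBox.1 h₁').2 (P.mem_pairBox.1 h₂').2 fun i j hij => ?_⟩
    · by_cases h : (j : ℕ) / 3 = 0
      · have := eI j h
        rwa [P.merge_of_not_paired hj, P.merge_of_not_paired hj] at this ⊢
      · have := eJ j h
        rwa [P.merge_of_not_paired hj, P.merge_of_not_paired hj] at this ⊢
    · by_cases h : (i : ℕ) / 3 = 0
      · exact Or.inl (eI i h)
      · have := hres i j hij
        have a1 := hlt i ⟨j, hij⟩
        have a2 := hlt j ⟨i, P.symm _ _ hij⟩
        exact Or.inr (eI j (by omega))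
    · by_cases h : (i : ℕ) / 3 = 0
      · exact Or.inr (eJ j fun h' => hres i j hij (h.trans h'.symm))
      · exact Or.inl (eJ i h)

/-- The estimate when the last index is paired. -/
lemma sum_sq_le_of_paired_six (hres : ∀ i j : Fin 7, P.rel i j → (i : ℕ) / 3 ≠ (j : ℕ) / 3)
    (α : ℝ) (K : ℕ) (h6 : P.Paired 6) :
    ∑ f ∈ P.freeBox (2 ^ K), (∑ g ∈ P.pairBox (2 ^ K) f,
        lamJ α K (P.merge f g 0) (P.merge f g 1) (P.merge f g 2) *
          (lamJ α K (P.merge f g 3) (P.merge f g 4) (P.merge f g 5) *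
            (jb (P.merge f g 6))⁻¹)) ^ 2 ≤
      (∑ a ∈ box (2 ^ K), ∑ b ∈ box (2 ^ K), ∑ c ∈ box (2 ^ K), lamJ α K a b c ^ 2) *
        ∑ a ∈ box (2 ^ K), ∑ b ∈ box (2 ^ K),
          (∑ z ∈ box (2 ^ K), lamJ α K a b z * (jb z)⁻¹) ^ 2 := by
  obtain ⟨p, hp⟩ := h6
  have hp := P.symm _ _ hp
  have hI : ∀ i j : Fin 7, P.rel i j → (i = 0 ∨ i = 1 ∨ i = 2) → (j = 0 ∨ j = 1 ∨ j = 2) →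
      False := fun i j hij hi hj => hres i j hij (by
    rcases hi with rfl | rfl | rfl <;> rcases hj with rfl | rfl | rfl <;> rfl)
  have hJ : ∀ i j : Fin 7, P.rel i j → (i = 3 ∨ i = 4 ∨ i = 5) → (j = 3 ∨ j = 4 ∨ j = 5) →
      False := fun i j hij hi hj => hres i j hij (by
    rcases hi with rfl | rfl | rfl <;> rcases hj with rfl | rfl | rfl <;> rfl)
  have hpd : p = 0 ∨ p = 1 ∨ p = 2 ∨ p = 3 ∨ p = 4 ∨ p = 5 := by
    have : p ≠ 6 := by rintro rfl; exact P.antirefl _ hp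
    omega
  have hcong : ∀ {i₀ i₁ i₂ j₀ j₁ : Fin 7}, (∀ n : Fin 7 → Fin 3 → ℤ,
      lamJ α K (n 0) (n 1) (n 2) * (lamJ α K (n 3) (n 4) (n 5) * (jb (n 6))⁻¹) =
        lamJ α K (n i₀) (n i₁) (n i₂) * (lamJ α K (n j₀) (n j₁) (n p) * (jb (n 6))⁻¹)) →
      ∑ f ∈ P.freeBox (2 ^ K), (∑ g ∈ P.pairBox (2 ^ K) f,
        lamJ α K (P.merge f g 0) (P.merge f g 1) (P.merge f g 2) *
          (lamJ α K (P.merge f g 3) (P.merge f g 4) (P.merge f g 5) *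
            (jb (P.merge f g 6))⁻¹)) ^ 2 =
      ∑ f ∈ P.freeBox (2 ^ K), (∑ g ∈ P.pairBox (2 ^ K) f,
        lamJ α K (P.merge f g i₀) (P.merge f g i₁) (P.merge f g i₂) *
          (lamJ α K (P.merge f g j₀) (P.merge f g j₁) (P.merge f g p) *
            (jb (P.merge f g 6))⁻¹)) ^ 2 := fun h =>
    Finset.sum_congr rfl fun f _ => congrArg (· ^ 2) (Finset.sum_congr rfl fun g _ => h _)
  rcases hpd with rfl | rfl | rfl | rfl | rfl | rfl
  · exact (hcong fun n => by
      rw [← lamJ_swap_left α K (n 0), ← lamJ_swap_right α K (n 1) (n 0)]; ring).trans_le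
      (P.sum_sq_le_of_rel_six α K (i₀ := 3) (i₁ := 4) (i₂ := 5) (j₀ := 1) (j₁ := 2)
        (by decide) hJ (fun i j h a b => hI i j h (by tauto) (by tauto))
        (by decide) hp)
  · exact (hcong fun n => by rw [← lamJ_swap_right α K (n 0) (n 1)]; ring).trans_le
      (P.sum_sq_le_of_rel_six α K (i₀ := 3) (i₁ := 4) (i₂ := 5) (j₀ := 0) (j₁ := 2)
        (by decide) hJ (fun i j h a b => hI i j h (by tauto) (by tauto))
        (by decide) hp)
  · exact (hcong fun n => by ring).trans_le
      (P.sum_sq_le_of_rel_six α K (i₀ := 3) (i₁ := 4) (i₂ := 5) (j₀ := 0) (j₁ := 1)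
        (by decide) hJ (fun i j h a b => hI i j h (by tauto) (by tauto))
        (by decide) hp)
  · exact (hcong fun n => by
      rw [← lamJ_swap_left α K (n 3), ← lamJ_swap_right α K (n 4) (n 3)]).trans_le
      (P.sum_sq_le_of_rel_six α K (i₀ := 0) (i₁ := 1) (i₂ := 2) (j₀ := 4) (j₁ := 5)
        (by decide) hI (fun i j h a b => hJ i j h (by tauto) (by tauto))
        (by decide) hp)
  · exact (hcong fun n => by rw [← lamJ_swap_right α K (n 3) (n 4)]).trans_le
      (P.sum_sq_le_of_rel_six α K (i₀ := 0) (i₁ := 1) (i₂ := 2) (j₀ := 3) (j₁ := 5)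
        (by decide) hI (fun i j h a b => hJ i j h (by tauto) (by tauto))
        (by decide) hp)
  · exact (hcong fun n => rfl).trans_le
      (P.sum_sq_le_of_rel_six α K (i₀ := 0) (i₁ := 1) (i₂ := 2) (j₀ := 3) (j₁ := 4)
        (by decide) hI (fun i j h a b => hJ i j h (by tauto) (by tauto))
        (by decide) hp)

end Pairing

/-- The counting estimate over the cube, with polynomial loss in the scale `K`. -/
lemma Pairing.sum_sq_le (P : Pairing 7)
    (hres : ∀ i j : Fin 7, P.rel i j → (i : ℕ) / 3 ≠ (j : ℕ) / 3) {α : ℝ} (h1 : 1 < α)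
    (h2 : α ≤ 2) [Fintype {j : Fin 7 // ¬P.Paired j}] :
    ∃ C > 0, ∀ K : ℕ, ∑ f ∈ P.freeBox (2 ^ K), (jb (∑ j, f j))⁻¹ * (∑ g ∈ P.pairBox (2 ^ K) f,
        lamJ α K (P.merge f g 0) (P.merge f g 1) (P.merge f g 2) *
          (lamJ α K (P.merge f g 3) (P.merge f g 4) (P.merge f g 5) *
            (jb (P.merge f g 6))⁻¹)) ^ 2 ≤ C * ((K : ℝ) + 1) ^ 10 := by
  obtain ⟨C₁, hC₁, hS⟩ := sum_sum_sum_lamJ_sq_le h1 h2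
  obtain ⟨C₂, hC₂, hT⟩ := sum_sum_contract_sq_le h1 h2
  have hK : ∀ K : ℕ, (1 : ℝ) ≤ K + 1 := fun K => by
    have := Nat.cast_nonneg (α := ℝ) K
    linarith
  by_cases h6 : P.Paired 6
  · refine ⟨C₁ * C₂, by positivity, fun K => ?_⟩
    calc _ ≤ _ := Finset.sum_le_sum fun f _ =>
          mul_le_of_le_one_left (sq_nonneg _) (inv_le_one_of_one_le₀ (one_le_jb _))
      _ ≤ _ := P.sum_sq_le_of_paired_six hres α K h6
      _ ≤ (C₁ * ((K : ℝ) + 1) ^ 4) * (C₂ * ((K : ℝ) + 1) ^ 6) :=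
          mul_le_mul (hS K) (hT K) (by positivity) (by positivity)
      _ = _ := by ring
  · refine ⟨2000 * C₁ ^ 2, by positivity, fun K => ?_⟩
    calc _ ≤ _ := P.sum_sq_le_of_not_paired_six hres α K h6
      _ ≤ 2000 * ((K : ℝ) + 1) * (C₁ * ((K : ℝ) + 1) ^ 4) ^ 2 := by
          gcongr
          exact hS K
      _ = 2000 * C₁ ^ 2 * ((K : ℝ) + 1) ^ 9 := by ring
      _ ≤ _ := by
          gcongr
          · exact hK K
          · norm_num

/-- Powers of the scale are dominated by powers of the frequency. -/
lemma exists_pow_le_rpow {δ : ℝ} (hδ : 0 < δ) :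
    ∃ C > 0, ∀ K : ℕ, ((K : ℝ) + 1) ^ 10 ≤ C * ((2 : ℝ) ^ K) ^ δ := by
  have hl : 0 < Real.log 2 := Real.log_pos one_lt_two
  set c := δ * Real.log 2 / 10 with hc
  have hc0 : 0 < c := by positivity
  refine ⟨(1 + 1 / c) ^ 10, by positivity, fun K => ?_⟩
  have hK : (0 : ℝ) ≤ K := Nat.cast_nonneg K
  have e : ((2 : ℝ) ^ K) ^ δ = Real.exp (c * K) ^ 10 := by
    rw [← Real.exp_nat_mul, Real.rpow_def_of_pos (by positivity), Real.log_pow]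
    congr 1
    rw [hc]; push_cast; ring
  rw [e, ← mul_pow]
  refine pow_le_pow_left₀ (by positivity) ?_ 10
  have h := Real.add_one_le_exp (c * K)
  calc (K : ℝ) + 1 ≤ (1 + 1 / c) * (c * K + 1) := by
        have : (1 + 1 / c) * (c * K + 1) = K + 1 + c * K + 1 / c := by field_simp; ring
        rw [this]
        have : 0 ≤ c * K + 1 / c := by positivity
        linarith
    _ ≤ _ := mul_le_mul_of_nonneg_left h (by positivity)

lemma exists_eq_sSup_dyadic {Nv : Fin 7 → ℝ} (h : ∀ j, IsDyadic (Nv j)) :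
    ∃ (K : ℕ) (j₀ : Fin 7), sSup (Set.range Nv) = 2 ^ K ∧ Nv j₀ = 2 ^ K ∧ ∀ j, Nv j ≤ 2 ^ K := by
  obtain ⟨j₀, hj₀⟩ := Finite.exists_max Nv
  obtain ⟨K, hK⟩ := h j₀
  refine ⟨K, j₀, ?_, hK, fun j => hK ▸ hj₀ j⟩
  rw [← hK]
  exact IsGreatest.csSup_eq ⟨⟨j₀, rfl⟩, by rintro _ ⟨j, rfl⟩; exact hj₀ j⟩

/-- The localized summand. -/
def locSummand (α : ℝ) (P : Pairing 7) (Nv : Fin 7 → ℝ) (n : Fin 7 → Fin 3 → ℤ) : ℝ :=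
  ind (∀ i j, P.rel i j → n i + n j = 0) * (∏ j, ind (SimFreq (Nv j) (n j))) *
    Lam α (n 0) (n 1) (n 2) * Lam α (n 3) (n 4) (n 5) * (jbb α (n 6))⁻¹

section locSummand

variable {α : ℝ} {P : Pairing 7} {Nv : Fin 7 → ℝ} {n : Fin 7 → Fin 3 → ℤ}

lemma locSummand_nonneg : 0 ≤ locSummand α P Nv n :=
  mul_nonneg (mul_nonneg (mul_nonneg (mul_nonneg (ind_nonneg _)
    (Finset.prod_nonneg fun _ _ => ind_nonneg _)) (Lam_nonneg _ _ _ _)) (Lam_nonneg _ _ _ _))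
    (inv_nonneg.2 (Real.sqrt_nonneg _))

lemma locSummand_eq_zero_of_not_adm (h : ¬P.Adm n) : locSummand α P Nv n = 0 := by
  have : ind (∀ i j, P.rel i j → n i + n j = 0) = 0 := if_neg h
  simp [locSummand, this]

lemma locSummand_eq_zero_of_not_simFreq {j : Fin 7} (h : ¬SimFreq (Nv j) (n j)) :
    locSummand α P Nv n = 0 := by
  have : ∏ j, ind (SimFreq (Nv j) (n j)) = 0 :=
    Finset.prod_eq_zero (Finset.mem_univ j) (if_neg h)
  simp [locSummand, this]

lemma locSummand_eq_zero_of_not_mem_box {K : ℕ} (hN : ∀ j, Nv j ≤ 2 ^ K) {j : Fin 7}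
    (h : n j ∉ box (2 ^ K)) : locSummand α P Nv n = 0 :=
  locSummand_eq_zero_of_not_simFreq fun h' => h (mem_box_of_simFreq (hN j) h')

lemma locSummand_le (h1 : 1 < α) (h2 : α ≤ 2) {K : ℕ} (hN : ∀ j, Nv j ≤ 2 ^ K) {j₀ : Fin 7}
    (hj₀ : Nv j₀ = 2 ^ K) : locSummand α P Nv n ≤ 1024 * ((2 : ℝ) ^ K) ^ (-(α - 1)) *
      (lamJ α K (n 0) (n 1) (n 2) * (lamJ α K (n 3) (n 4) (n 5) * (jb (n 6))⁻¹)) := by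
  by_cases hs : ∀ j, SimFreq (Nv j) (n j)
  · have hprod : ∏ j, ind (SimFreq (Nv j) (n j)) = 1 :=
      Finset.prod_eq_one fun j _ => if_pos (hs j)
    rw [← mul_assoc (lamJ α K _ _ _)]
    refine le_trans ?_ (summand_le h1 h2 (fun j => mem_box_of_simFreq (hN j) (hs j))
      (hj₀ ▸ hs j₀))
    rw [locSummand, hprod, mul_one, mul_assoc, mul_assoc, mul_assoc]
    exact mul_le_of_le_one_left (mul_nonneg (Lam_nonneg _ _ _ _) (mul_nonneg (Lam_nonneg _ _ _ _)
      (inv_nonneg.2 (Real.sqrt_nonneg _)))) (ind_le_one _)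
  · push Not at hs
    obtain ⟨j, hj⟩ := hs
    rw [locSummand_eq_zero_of_not_simFreq hj]
    exact mul_nonneg (by positivity) (mul_nonneg (lamJ_nonneg _ _ _ _ _)
      (mul_nonneg (lamJ_nonneg _ _ _ _ _) (inv_nonneg.2 (jb_pos _).le)))

/-- The sum over the paired variables is a finite sum. -/
lemma tsum_locSummand_eq {K : ℕ} (hN : ∀ j, Nv j ≤ 2 ^ K)
    (f : {j : Fin 7 // ¬P.Paired j} → Fin 3 → ℤ) :
    ∑' g, locSummand α P Nv (P.merge f g) =
      ∑ g ∈ P.pairBox (2 ^ K) f, locSummand α P Nv (P.merge f g) := by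
  refine tsum_eq_sum fun g hg => ?_
  rw [P.mem_pairBox, not_and_or, not_forall] at hg
  rcases hg with ⟨⟨j, hj⟩, h⟩ | h
  · refine locSummand_eq_zero_of_not_mem_box hN (j := j) ?_
    rwa [P.merge_of_paired hj]
  · exact locSummand_eq_zero_of_not_adm h

end locSummand

open Classical in
/-- **Septic counting estimate** (Lemma 3.11): let `1 < α ≤ 3/2` and let `𝒫` be a
pairing of `{1,…,7}` respecting the partition `{1,2,3}, {4,5,6}, {7}` (indices `0`–`6`
with blocks given by `⌊j/3⌋`).  Then there exist `θ > 0` and `C > 0`, depending only on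
`α` and `𝒫`, such that for all dyadic `N₁,…,N₇ ≥ 1`,
`Σ_{(n_j)_{j∉𝒫}} ⟨n_nr⟩⁻¹ ( Σ_{(n_j)_{j∈𝒫} admissible} (Π_j 1_{|n_j|∼N_j})
  Λ(n₁,n₂,n₃) Λ(n₄,n₅,n₆) ⟪n₇⟫⁻¹ )² ≤ C · N_max^{−θ}`. -/
theorem septic_counting (α : ℝ) (hα₁ : 1 < α) (hα₂ : α ≤ 3 / 2)
    (P : Pairing 7) (hres : ∀ i j : Fin 7, P.rel i j → (i : ℕ) / 3 ≠ (j : ℕ) / 3) :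
    ∃ θ C : ℝ, 0 < θ ∧ 0 < C ∧
      ∀ Nv : Fin 7 → ℝ, (∀ j, IsDyadic (Nv j)) →
        (∑' f : {j : Fin 7 // ¬P.Paired j} → Fin 3 → ℤ,
            (jb (∑ j, f j))⁻¹ *
              (∑' g : {j : Fin 7 // P.Paired j} → Fin 3 → ℤ,
                  (fun n : Fin 7 → Fin 3 → ℤ =>
                      ind (∀ i j, P.rel i j → n i + n j = 0) *
                        (∏ j, ind (SimFreq (Nv j) (n j))) *
                        Lam α (n 0) (n 1) (n 2) * Lam α (n 3) (n 4) (n 5) *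
                        (jbb α (n 6))⁻¹)
                    (fun j => if h : P.Paired j then g ⟨j, h⟩ else f ⟨j, h⟩)) ^ 2)
          ≤ C * sSup (Set.range Nv) ^ (-θ) := by
  have h2 : α ≤ 2 := by linarith
  have hδ : 0 < α - 1 := by linarith
  obtain ⟨C, hC, hsum⟩ := P.sum_sq_le hres hα₁ h2
  obtain ⟨D, hD, hpow⟩ := exists_pow_le_rpow hδ
  refine ⟨α - 1, 1024 ^ 2 * (C * D), hδ, by positivity, fun Nv hNv => ?_⟩
  obtain ⟨K, j₀, hsup, hj₀, hN⟩ := exists_eq_sSup_dyadic hNv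
  rw [hsup]
  set r : ℝ := ((2 : ℝ) ^ K) ^ (-(α - 1)) with hr
  have hr0 : 0 < r := by positivity
  have hrr : r * ((2 : ℝ) ^ K) ^ (α - 1) = 1 := by
    rw [hr, ← Real.rpow_add (by positivity), neg_add_cancel, Real.rpow_zero]
  change ∑' f : {j : Fin 7 // ¬P.Paired j} → Fin 3 → ℤ,
    (jb (∑ j, f j))⁻¹ * (∑' g, locSummand α P Nv (P.merge f g)) ^ 2 ≤ _
  rw [tsum_eq_sum (s := P.freeBox (2 ^ K)) fun f hf => ?_]
  · calc _ ≤ ∑ f ∈ P.freeBox (2 ^ K), 1024 ^ 2 * r ^ 2 * ((jb (∑ j, f j))⁻¹ *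
          (∑ g ∈ P.pairBox (2 ^ K) f,
            lamJ α K (P.merge f g 0) (P.merge f g 1) (P.merge f g 2) *
              (lamJ α K (P.merge f g 3) (P.merge f g 4) (P.merge f g 5) *
                (jb (P.merge f g 6))⁻¹)) ^ 2) := by
          refine Finset.sum_le_sum fun f _ => ?_
          rw [mul_left_comm, ← mul_pow, ← mul_pow, tsum_locSummand_eq hN, Finset.mul_sum]
          refine mul_le_mul_of_nonneg_left (pow_le_pow_left₀
            (Finset.sum_nonneg fun _ _ => locSummand_nonneg)
            (Finset.sum_le_sum fun g _ => locSummand_le hα₁ h2 hN hj₀) 2)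
            (inv_nonneg.2 (jb_pos _).le)
      _ ≤ 1024 ^ 2 * r ^ 2 * (C * (D * ((2 : ℝ) ^ K) ^ (α - 1))) := by
          rw [← Finset.mul_sum]
          exact mul_le_mul_of_nonneg_left ((hsum K).trans
            (mul_le_mul_of_nonneg_left (hpow K) hC.le)) (by positivity)
      _ = 1024 ^ 2 * (C * D) * r * (r * ((2 : ℝ) ^ K) ^ (α - 1)) := by ring
      _ = _ := by rw [hrr, mul_one]
  · rw [P.mem_freeBox, not_forall] at hf
    obtain ⟨⟨j, hj⟩, h⟩ := hf
    have : ∀ g, locSummand α P Nv (P.merge f g) = 0 := fun g =>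
      locSummand_eq_zero_of_not_mem_box hN (j := j) (by rwa [P.merge_of_not_paired hj])
    simp [this]
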